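/- arXiv:2207.06979 — 3 statements merged into one kernel-verified Lean document; each statement's English description precedes it below -/
import Mathlib

section
/- Let d ≥ 1, β ∈ (0,d], and let Q₀ ⊂ ℝ^d be a cube. There exist constants c, C > 0 depending only on β and d such that for every u ∈ BMO^β(Q₀) with ‖u‖_{BMO^β(Q₀)} > 0, every finite subcube Q ⊂ Q₀ parallel to Q₀, and every t > 0, there exists c_Q ∈ ℝ (depending on u and Q but not on t) with 𝓗^β_∞({x ∈ Q : |u(x) − c_Q| > t}) ≤ C · l(Q)^β · exp(−c t / ‖u‖_{BMO^β(Q₀)}). -/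
open Set MeasureTheory ENNReal NNReal Filter

noncomputable section

/-- `ℝ^d` with the Euclidean metric. -/
abbrev Euc (d : ℕ) : Type := EuclideanSpace ℝ (Fin d)

/-- An axis-parallel cube in `ℝ^d`, given by its lower corner and (positive) side length. -/
structure Cube (d : ℕ) where
  corner : Fin d → ℝ
  side : ℝ
  side_pos : 0 < side

namespace Cube

/-- The (half-open) set of points of the cube. -/
def set {d : ℕ} (Q : Cube d) : Set (Euc d) :=
  {x : Euc d | ∀ i, Q.corner i ≤ x i ∧ x i < Q.corner i + Q.side}

/-- The dyadic lattice `𝓓(Q)` generated by `Q`: all cubes of side `l(Q)·2ⁿ` (`n : ℤ`) with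
corners on the correspondingly rescaled grid anchored at the corner of `Q`; equivalently `Q`,
its dyadic ancestors, and all of their repeated dyadic subdivisions. -/
def dyadic {d : ℕ} (Q : Cube d) : Set (Cube d) :=
  {Q' | ∃ (n : ℤ) (k : Fin d → ℤ), Q'.side = Q.side * 2 ^ n ∧
    ∀ i, Q'.corner i = Q.corner i + (k i : ℝ) * (Q.side * 2 ^ n)}

end Cube

/-- The spherical Hausdorff content `𝓗^β_∞`, with `ω_β = π^{β/2}/Γ(β/2+1)`. -/
def hausdorffContent (d : ℕ) (β : ℝ) (E : Set (Euc d)) : ℝ≥0∞ :=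
  ⨅ (c : ℕ → Euc d × ℝ) (_ : E ⊆ ⋃ i, Metric.ball (c i).1 (c i).2),
    ∑' i, ENNReal.ofReal (Real.pi ^ (β / 2) / Real.Gamma (β / 2 + 1) * (c i).2 ^ β)

/-- The dyadic Hausdorff content `𝓗^{β,Q}_∞` adapted to the cube `Q`. -/
def dyadicContent (d : ℕ) (β : ℝ) (Q : Cube d) (E : Set (Euc d)) : ℝ≥0∞ :=
  ⨅ (c : ℕ → Cube d) (_ : ∀ i, c i ∈ Q.dyadic) (_ : E ⊆ ⋃ i, (c i).set),
    ∑' i, ENNReal.ofReal ((c i).side ^ β)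

/-- The Choquet integral `∫_A f dH := ∫_0^∞ H({x ∈ A : f x > t}) dt`. -/
def choquetIntegral {X : Type*} (H : Set X → ℝ≥0∞) (A : Set X) (f : X → ℝ) : ℝ≥0∞ :=
  ∫⁻ t in Set.Ioi (0 : ℝ), H {x | x ∈ A ∧ t < f x}

/-- `f` is `H`-quasicontinuous: for every `ε > 0` there is an open set `O` with `H O < ε`
such that `f` restricted to `Oᶜ` is continuous. -/
def QuasiContinuous {X : Type*} [TopologicalSpace X] (H : Set X → ℝ≥0∞) (f : X → ℝ) : Prop :=
  ∀ ε : ℝ, 0 < ε → ∃ O : Set X, IsOpen O ∧ H O < ENNReal.ofReal ε ∧ ContinuousOn f Oᶜ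

/-- `f ∈ L¹(A; H)`: `f` is `H`-quasicontinuous and `∫_A |f| dH < ∞`. -/
def MemChoquetL1 {X : Type*} [TopologicalSpace X] (H : Set X → ℝ≥0∞) (A : Set X)
    (f : X → ℝ) : Prop :=
  QuasiContinuous H f ∧ choquetIntegral H A (fun x => |f x|) < ⊤

/-- The `BMO^β(Q₀)` seminorm: `sup_{Q ⊆ Q₀} inf_{c ∈ ℝ} l(Q)^{-β} ∫_Q |u - c| d𝓗^β_∞`. -/
def bmoSeminorm (d : ℕ) (β : ℝ) (Q₀ : Set (Euc d)) (u : Euc d → ℝ) : ℝ≥0∞ :=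
  ⨆ (Q : Cube d) (_ : Q.set ⊆ Q₀),
    ⨅ c : ℝ, choquetIntegral (hausdorffContent d β) Q.set (fun x => |u x - c|) /
      ENNReal.ofReal (Q.side ^ β)

/-- Membership in `BMO^β(Q₀)`. -/
def MemBMO (d : ℕ) (β : ℝ) (Q₀ : Set (Euc d)) (u : Euc d → ℝ) : Prop :=
  MemChoquetL1 (hausdorffContent d β) Q₀ u ∧ bmoSeminorm d β Q₀ u < ⊤


/-- The classical John–Nirenberg BMO seminorm on `Q₀` with respect to Lebesgue measure. -/
def bmoClassical (d : ℕ) (Q₀ : Set (Euc d)) (u : Euc d → ℝ) : ℝ≥0∞ :=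
  ⨆ (Q : Cube d) (_ : Q.set ⊆ Q₀),
    (volume Q.set)⁻¹ * ∫⁻ x in Q.set, ENNReal.ofReal |u x - ⨍ y in Q.set, u y|

/-- The axis-parallel affine subspace of `ℝ^d` obtained by freeing the coordinates in `S`
and fixing the remaining coordinates to the values of `b`. -/
def hyperplane (d : ℕ) (S : Finset (Fin d)) (b : Fin d → ℝ) : Set (Euc d) :=
  {x : Euc d | ∀ i ∉ S, x i = b i}

/-- The classical BMO seminorm of `u` on `Q₀ ∩ H` with respect to the `k`-dimensional
Hausdorff measure `𝓗^k`, the supremum being over the subcubes `Q.set ∩ H ⊆ Q₀ ∩ H`. -/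
def bmoClassicalOnPlane (d k : ℕ) (Q₀ : Cube d) (H : Set (Euc d)) (u : Euc d → ℝ) : ℝ≥0∞ :=
  ⨆ (Q : Cube d) (_ : Q.set ∩ H ⊆ Q₀.set),
    (Measure.hausdorffMeasure (k : ℝ) (Q.set ∩ H))⁻¹ *
      ∫⁻ x in Q.set ∩ H,
        ENNReal.ofReal |u x - ⨍ y in Q.set ∩ H, u y ∂(Measure.hausdorffMeasure (k : ℝ))|
          ∂(Measure.hausdorffMeasure (k : ℝ))

/-- The unique dyadic cube of `𝓓(Q)` of generation `n` (side `l(Q)·2^{-n}`) containing `x`. -/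
def dyadicCubeAt {d : ℕ} (Q : Cube d) (n : ℕ) (x : Euc d) : Cube d where
  corner := fun i => Q.corner i + Q.side * (2 : ℝ)⁻¹ ^ n *
    (⌊(x i - Q.corner i) / (Q.side * (2 : ℝ)⁻¹ ^ n)⌋ : ℝ)
  side := Q.side * (2 : ℝ)⁻¹ ^ n
  side_pos := by have := Q.side_pos; positivity

/-- The dyadic `β`-Hausdorff maximal function associated to `𝓗^{β,Q}_∞`. -/
def dyadicMaximal (d : ℕ) (β : ℝ) (Q : Cube d) (f : Euc d → ℝ) (x : Euc d) : ℝ≥0∞ :=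
  ⨆ (Q' : Cube d) (_ : Q' ∈ Q.dyadic) (_ : x ∈ Q'.set),
    choquetIntegral (dyadicContent d β Q) Q'.set (fun y => |f y|) / ENNReal.ofReal (Q'.side ^ β)

/-- The `BMO^{β,p}(Q₀)` seminorm. -/
def bmoSeminormP (d : ℕ) (β p : ℝ) (Q₀ : Set (Euc d)) (u : Euc d → ℝ) : ℝ≥0∞ :=
  ⨆ (Q : Cube d) (_ : Q.set ⊆ Q₀),
    ⨅ c : ℝ, (choquetIntegral (hausdorffContent d β) Q.set (fun x => |u x - c| ^ p) /
      ENNReal.ofReal (Q.side ^ β)) ^ (1 / p)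

/-- The standard normalization constant `γ(α) = π^{d/2} 2^α Γ(α/2) / Γ((d-α)/2)`. -/
def rieszConst (d : ℕ) (α : ℝ) : ℝ :=
  Real.pi ^ ((d : ℝ) / 2) * 2 ^ α * Real.Gamma (α / 2) / Real.Gamma (((d : ℝ) - α) / 2)

/-- The Riesz potential `I_α μ (x) = γ(α)⁻¹ ∫ |x - y|^{α - d} dμ(y)`. -/
def rieszPotential (d : ℕ) (α : ℝ) (μ : Measure (Euc d)) (x : Euc d) : ℝ :=
  (rieszConst d α)⁻¹ * (∫⁻ y, ENNReal.ofReal (‖x - y‖ ^ (α - (d : ℝ))) ∂μ).toReal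

/-- The Morrey norm `‖μ‖_{ℳ^γ} = sup_{x, r>0} μ(B(x,r))/r^γ`. -/
def morreyNorm (d : ℕ) (γ : ℝ) (μ : Measure (Euc d)) : ℝ≥0∞ :=
  ⨆ (x : Euc d) (r : ℝ) (_ : 0 < r), μ (Metric.ball x r) / ENNReal.ofReal (r ^ γ)

/-- The dyadic `BMO^β_*(Q₀)` seminorm, where for each subcube `Q` the dyadic Hausdorff
content adapted to that `Q` is used. -/
def bmoDyadicSeminorm (d : ℕ) (β : ℝ) (Q₀ : Set (Euc d)) (u : Euc d → ℝ) : ℝ≥0∞ :=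
  ⨆ (Q : Cube d) (_ : Q.set ⊆ Q₀),
    ⨅ c : ℝ, choquetIntegral (dyadicContent d β Q) Q.set (fun x => |u x - c|) /
      ENNReal.ofReal (Q.side ^ β)

/-- A (possibly infinite) cube in `ℝ^d`: either a finite cube, or a product of intervals
which are infinite in every coordinate direction. -/
def IsGenCube (d : ℕ) (S : Set (Euc d)) : Prop :=
  (∃ Q : Cube d, S = Q.set) ∨
  (∃ I : Fin d → Set ℝ,
      (∀ i, (∃ a, I i = Set.Ici a) ∨ (∃ b, I i = Set.Iio b) ∨ I i = Set.univ) ∧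
      S = {x : Euc d | ∀ i, x i ∈ I i})

/-- The Choquet integral of an `ℝ≥0∞`-valued function. -/
def choquetIntegralE {X : Type*} (H : Set X → ℝ≥0∞) (f : X → ℝ≥0∞) : ℝ≥0∞ :=
  ∫⁻ t in Set.Ioi (0 : ℝ), H {x | ENNReal.ofReal t < f x}

/-- The normalizing constant `ω_β`. -/
def ballConst (β : ℝ) : ℝ := Real.pi ^ (β / 2) / Real.Gamma (β / 2 + 1)

lemma ballConst_pos {β : ℝ} (hβ : 0 < β) : 0 < ballConst β := by
  unfold ballConst
  have : 0 < Real.Gamma (β / 2 + 1) := Real.Gamma_pos_of_pos (by positivity)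
  positivity

lemma hausdorffContent_le_tsum {d : ℕ} {β : ℝ} {E : Set (Euc d)} (c : ℕ → Euc d × ℝ)
    (hc : E ⊆ ⋃ i, Metric.ball (c i).1 (c i).2) :
    hausdorffContent d β E ≤ ∑' i, ENNReal.ofReal (ballConst β * (c i).2 ^ β) :=
  iInf₂_le c hc

lemma exists_ball_cover_of_hausdorffContent_lt {d : ℕ} {β : ℝ} {E : Set (Euc d)} {a : ℝ≥0∞}
    (h : hausdorffContent d β E < a) :
    ∃ c : ℕ → Euc d × ℝ, E ⊆ ⋃ i, Metric.ball (c i).1 (c i).2 ∧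
      ∑' i, ENNReal.ofReal (ballConst β * (c i).2 ^ β) < a := by
  unfold hausdorffContent at h
  simp only [iInf_lt_iff] at h
  obtain ⟨c, hc, hlt⟩ := h
  exact ⟨c, hc, hlt⟩

lemma hausdorffContent_mono {d : ℕ} {β : ℝ} {E F : Set (Euc d)} (h : E ⊆ F) :
    hausdorffContent d β E ≤ hausdorffContent d β F :=
  le_iInf₂ fun c hc => hausdorffContent_le_tsum c (h.trans hc)

lemma hausdorffContent_le_of_subset_ball {d : ℕ} {β : ℝ} (hβ : 0 < β) {E : Set (Euc d)}
    {x : Euc d} {r : ℝ} (h : E ⊆ Metric.ball x r) :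
    hausdorffContent d β E ≤ ENNReal.ofReal (ballConst β * r ^ β) := by
  refine (hausdorffContent_le_tsum (fun i => if i = 0 then (x, r) else (x, 0)) ?_).trans ?_
  · refine h.trans fun y hy => mem_iUnion.2 ⟨0, by simpa using hy⟩
  · rw [tsum_eq_single 0]
    · simp
    · intro i hi
      simp [hi, Real.zero_rpow hβ.ne']

/-- The Hausdorff content as an outer measure. -/
def contentOuterMeasure (d : ℕ) {β : ℝ} (hβ : 0 < β) : OuterMeasure (Euc d) where
  measureOf := hausdorffContent d β
  empty := by
    have := hausdorffContent_le_of_subset_ball (d := d) hβ (E := ∅) (x := 0) (r := 0) (by simp)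
    simpa [Real.zero_rpow hβ.ne'] using this
  mono := fun h => hausdorffContent_mono h
  iUnion_nat := by
    intro E _
    by_cases hfin : ∑' i, hausdorffContent d β (E i) = ⊤
    · rw [hfin]; exact le_top
    refine ENNReal.le_of_forall_pos_le_add fun ε hε _ => ?_
    obtain ⟨ε', hε'0, hε'⟩ := ENNReal.exists_pos_sum_of_countable
      (ENNReal.coe_ne_zero.2 hε.ne') ℕ
    have hlt : ∀ i, hausdorffContent d β (E i) < hausdorffContent d β (E i) + ε' i := fun i =>
      ENNReal.lt_add_right (ENNReal.ne_top_of_tsum_ne_top hfin i)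
        (ENNReal.coe_ne_zero.2 (hε'0 i).ne')
    choose c hc hsum using fun i => exists_ball_cover_of_hausdorffContent_lt (hlt i)
    refine (hausdorffContent_le_tsum
      (fun n => c (Nat.pairEquiv.symm n).1 (Nat.pairEquiv.symm n).2) ?_).trans ?_
    · refine iUnion_subset fun i x hx => ?_
      obtain ⟨j, hj⟩ := mem_iUnion.1 (hc i hx)
      exact mem_iUnion.2 ⟨Nat.pairEquiv (i, j), by simpa using hj⟩
    · rw [Nat.pairEquiv.symm.tsum_eq
        (fun p : ℕ × ℕ => ENNReal.ofReal (ballConst β * (c p.1 p.2).2 ^ β)),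
        ENNReal.tsum_prod (f := fun i j => ENNReal.ofReal (ballConst β * (c i j).2 ^ β))]
      calc _ ≤ ∑' i, (hausdorffContent d β (E i) + ε' i) :=
            ENNReal.tsum_le_tsum fun i => (hsum i).le
        _ = _ := ENNReal.tsum_add
        _ ≤ _ := by gcongr

lemma hausdorffContent_iUnion_le {d : ℕ} {β : ℝ} (hβ : 0 < β) {ι : Type*} [Countable ι]
    (E : ι → Set (Euc d)) :
    hausdorffContent d β (⋃ i, E i) ≤ ∑' i, hausdorffContent d β (E i) :=
  measure_iUnion_le (μ := contentOuterMeasure d hβ) E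

lemma hausdorffContent_union_le {d : ℕ} {β : ℝ} (hβ : 0 < β) (E F : Set (Euc d)) :
    hausdorffContent d β (E ∪ F) ≤ hausdorffContent d β E + hausdorffContent d β F :=
  measure_union_le (μ := contentOuterMeasure d hβ) E F

lemma Cube.volume_set {d : ℕ} (Q : Cube d) : volume Q.set = ENNReal.ofReal (Q.side ^ d) := by
  have h : Q.set = (MeasurableEquiv.toLp 2 (Fin d → ℝ)).symm ⁻¹'
      (Set.univ.pi fun i => Set.Ico (Q.corner i) (Q.corner i + Q.side)) := by
    ext x
    simp [Cube.set]
  rw [h, (EuclideanSpace.volume_preserving_symm_measurableEquiv_toLp (Fin d)).measure_preimage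
    (MeasurableSet.univ_pi fun i => measurableSet_Ico).nullMeasurableSet, Real.volume_pi_Ico]
  simp [ENNReal.ofReal_pow Q.side_pos.le]

lemma volume_ball_le {d : ℕ} (x : Euc d) {r : ℝ} (hr : 0 < r) :
    volume (Metric.ball x r) ≤ ENNReal.ofReal ((2 * r) ^ d) := by
  refine le_trans (measure_mono ?_)
    (Cube.volume_set ⟨fun i => x i - r, 2 * r, by positivity⟩).le
  intro y hy i
  have h1 : |y i - x i| < r := by
    have := PiLp.norm_apply_le (y - x) i
    rw [mem_ball_iff_norm] at hy
    simpa using this.trans_lt hy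
  rw [abs_lt] at h1
  constructor <;> simp only <;> linarith

lemma Cube.le_hausdorffContent_set {d : ℕ} {β : ℝ} (hβ : 0 < β) (hβd : β ≤ d) (Q : Cube d) :
    ENNReal.ofReal (ballConst β / 2 ^ d * Q.side ^ β) ≤ hausdorffContent d β Q.set := by
  have hω := ballConst_pos hβ
  have hl := Q.side_pos
  refine le_iInf₂ fun c hc => ?_
  change _ ≤ ∑' i, ENNReal.ofReal (ballConst β * (c i).2 ^ β)
  by_cases hbig : ∃ i, Q.side < (c i).2
  · obtain ⟨i, hi⟩ := hbig
    refine le_trans (ENNReal.ofReal_le_ofReal ?_) (ENNReal.le_tsum i)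
    have : ballConst β / 2 ^ d ≤ ballConst β := div_le_self hω.le (one_le_pow₀ one_le_two)
    gcongr
  · push Not at hbig
    have hkey : ∀ i, volume (Metric.ball (c i).1 (c i).2) ≤
        ENNReal.ofReal (2 ^ d * Q.side ^ (d - β) / ballConst β) *
          ENNReal.ofReal (ballConst β * (c i).2 ^ β) := by
      intro i
      rcases le_or_gt (c i).2 0 with h0 | h0
      · simp [Metric.ball_eq_empty.2 h0]
      refine (volume_ball_le _ h0).trans ?_
      rw [← ENNReal.ofReal_mul (by positivity)]
      refine ENNReal.ofReal_le_ofReal ?_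
      have h1 : (c i).2 ^ d = (c i).2 ^ ((d : ℝ) - β) * (c i).2 ^ β := by
        rw [← Real.rpow_add h0, sub_add_cancel, Real.rpow_natCast]
      have h2 : (c i).2 ^ ((d : ℝ) - β) ≤ Q.side ^ ((d : ℝ) - β) :=
        Real.rpow_le_rpow h0.le (hbig i) (by linarith)
      calc (2 * (c i).2) ^ d = 2 ^ d * ((c i).2 ^ ((d : ℝ) - β) * (c i).2 ^ β) := by
            rw [mul_pow, h1]
        _ ≤ 2 ^ d * (Q.side ^ ((d : ℝ) - β) * (c i).2 ^ β) := by gcongr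
        _ = _ := by field_simp
    have hvol : ENNReal.ofReal (Q.side ^ d) ≤
        ENNReal.ofReal (2 ^ d * Q.side ^ (d - β) / ballConst β) *
          ∑' i, ENNReal.ofReal (ballConst β * (c i).2 ^ β) := by
      rw [← Q.volume_set, ← ENNReal.tsum_mul_left]
      exact (measure_mono hc).trans ((measure_iUnion_le _).trans (ENNReal.tsum_le_tsum hkey))
    have hpos : 0 < 2 ^ d * Q.side ^ (d - β) / ballConst β := by positivity
    refine (ENNReal.mul_le_mul_iff_right (ENNReal.ofReal_pos.2 hpos).ne'
      ENNReal.ofReal_ne_top).1 (le_trans (le_of_eq ?_) hvol)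
    rw [← ENNReal.ofReal_mul hpos.le]
    congr 1
    have h1 : Q.side ^ d = Q.side ^ ((d : ℝ) - β) * Q.side ^ β := by
      rw [← Real.rpow_add hl, sub_add_cancel, Real.rpow_natCast]
    rw [h1]
    field_simp

lemma Cube.hausdorffContent_set_le {d : ℕ} {β : ℝ} (hβ : 0 < β) (Q : Cube d) :
    hausdorffContent d β Q.set ≤
      ENNReal.ofReal (ballConst β * (d + 1 : ℝ) ^ β * Q.side ^ β) := by
  have hl := Q.side_pos
  have h : Q.set ⊆ Metric.ball (WithLp.toLp 2 Q.corner) ((d + 1) * Q.side) := by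
    intro x hx
    rw [mem_ball_iff_norm]
    have h1 : ∀ i, ‖(x - WithLp.toLp 2 Q.corner) i‖ ^ 2 ≤ Q.side ^ 2 := by
      intro i
      have := hx i
      simp only [PiLp.sub_apply, Real.norm_eq_abs, sq_abs]
      nlinarith
    have h2 : ‖x - WithLp.toLp 2 Q.corner‖ ^ 2 ≤ d * Q.side ^ 2 := by
      rw [EuclideanSpace.norm_sq_eq]
      exact (Finset.sum_le_sum fun i _ => h1 i).trans (by simp)
    refine lt_of_pow_lt_pow_left₀ 2 (by positivity) (h2.trans_lt ?_)
    have : (0 : ℝ) ≤ d := d.cast_nonneg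
    rw [mul_pow]
    gcongr
    nlinarith
  refine (hausdorffContent_le_of_subset_ball hβ h).trans_eq ?_
  rw [Real.mul_rpow (by positivity) hl.le, mul_assoc]

lemma mul_hausdorffContent_le_choquetIntegral {d : ℕ} {β : ℝ} (A : Set (Euc d))
    (f : Euc d → ℝ) (t : ℝ) :
    ENNReal.ofReal t * hausdorffContent d β {x ∈ A | t < f x} ≤
      choquetIntegral (hausdorffContent d β) A f := by
  calc ENNReal.ofReal t * hausdorffContent d β {x ∈ A | t < f x}
      = ∫⁻ _ in Set.Ioo 0 t, hausdorffContent d β {x ∈ A | t < f x} := by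
        rw [setLIntegral_const, Real.volume_Ioo, sub_zero, mul_comm]
    _ ≤ ∫⁻ s in Set.Ioo 0 t, hausdorffContent d β {x | x ∈ A ∧ s < f x} :=
        setLIntegral_mono' measurableSet_Ioo fun s hs =>
          hausdorffContent_mono fun x hx => ⟨hx.1, hs.2.trans hx.2⟩
    _ ≤ _ := lintegral_mono_set fun s hs => hs.1

/-- The ancestor of generation `m` of the dyadic index `p` (meaningful for `m ≤ p.1`). -/
def dyadicAncestor {d : ℕ} (p : ℕ × (Fin d → ℤ)) (m : ℕ) : Fin d → ℤ :=
  fun i => p.2 i / ((2 ^ (p.1 - m) : ℕ) : ℤ)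

/-- The dyadic indices descending from `p`, including `p` itself. -/
def dyadicDescendants {d : ℕ} (p : ℕ × (Fin d → ℤ)) : Set (ℕ × (Fin d → ℤ)) :=
  {q | p.1 ≤ q.1 ∧ dyadicAncestor q p.1 = p.2}

lemma dyadicAncestor_self {d : ℕ} (p : ℕ × (Fin d → ℤ)) : dyadicAncestor p p.1 = p.2 := by
  ext i; simp [dyadicAncestor]

lemma dyadicAncestor_dyadicAncestor {d : ℕ} (p : ℕ × (Fin d → ℤ)) {j m : ℕ} (hj : j ≤ m)
    (hm : m ≤ p.1) : dyadicAncestor (m, dyadicAncestor p m) j = dyadicAncestor p j := by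
  ext i
  simp only [dyadicAncestor]
  rw [Int.ediv_ediv_of_nonneg (by positivity), ← Nat.cast_mul, ← pow_add]
  congr 4
  omega

/-- Maximal nodes at which the weight of `S` exceeds `δ f`. -/
lemma exists_maximal_heavy_nodes {d : ℕ} (S : Set (ℕ × (Fin d → ℤ)))
    {f : ℕ × (Fin d → ℤ) → ℝ≥0∞} (hf0 : ∀ p, f p ≠ 0) (hf : ∀ p, f p ≠ ⊤)
    {δ : ℝ≥0∞} (hδ : δ < 1) :
    ∃ M : Set (ℕ × (Fin d → ℤ)),
      (∀ q ∈ S, ∃ p ∈ M, q ∈ dyadicDescendants p) ∧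
      δ * ∑' p : M, f p ≤ ∑' q : S, f q ∧
      ∀ p ∈ M, δ * f p < ∑' q : ↥(S ∩ dyadicDescendants p), f q ∧
        ∀ m < p.1, (m, dyadicAncestor p m) ∉ S ∧
          ∑' q : ↥(S ∩ dyadicDescendants (m, dyadicAncestor p m)), f q ≤
            δ * f (m, dyadicAncestor p m) := by
  classical
  let bad : ℕ × (Fin d → ℤ) → Prop :=
    fun p => δ * f p < ∑' q : ↥(S ∩ dyadicDescendants p), f q
  have bad_of_mem : ∀ q ∈ S, bad q := by
    intro q hq
    have h1 : δ * f q < 1 * f q := ENNReal.mul_lt_mul_left (hf0 q) (hf q) hδ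
    have h2 := ENNReal.le_tsum (f := fun r : ↥(S ∩ dyadicDescendants q) => f r)
      ⟨q, hq, le_rfl, dyadicAncestor_self q⟩
    rw [one_mul] at h1
    exact h1.trans_le h2
  let M : Set (ℕ × (Fin d → ℤ)) := {p | bad p ∧ ∀ m < p.1, ¬ bad (m, dyadicAncestor p m)}
  refine ⟨M, ?_, ?_, ?_⟩
  · intro q hq
    have hex : ∃ m, bad (m, dyadicAncestor q m) :=
      ⟨q.1, by rw [dyadicAncestor_self]; exact bad_of_mem q hq⟩
    have hle : Nat.find hex ≤ q.1 :=
      Nat.find_min' hex (by rw [dyadicAncestor_self]; exact bad_of_mem q hq)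
    refine ⟨(Nat.find hex, dyadicAncestor q (Nat.find hex)), ⟨Nat.find_spec hex, ?_⟩, hle, rfl⟩
    intro m hm
    simp only at hm ⊢
    rw [dyadicAncestor_dyadicAncestor q hm.le hle]
    exact Nat.find_min hex hm
  · have key : ∀ p ∈ M, ∀ p' ∈ M, ∀ q ∈ dyadicDescendants p, q ∈ dyadicDescendants p' →
        p'.1 ≤ p.1 := by
      intro p hp p' hp' q hq hq'
      by_contra! hlt
      have hp'q : p' = (p'.1, dyadicAncestor q p'.1) := Prod.ext rfl hq'.2.symm
      refine hp'.2 p.1 hlt ?_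
      rw [hp'q, dyadicAncestor_dyadicAncestor q hlt.le hq'.1, hq.2]
      exact hp.1
    rw [← ENNReal.tsum_mul_left]
    calc ∑' p : M, δ * f p ≤ ∑' p : M, ∑' q : ↥(S ∩ dyadicDescendants p.1), f q :=
          ENNReal.tsum_le_tsum fun p => p.2.1.le
      _ = ∑' x : (Σ p : M, ↥(S ∩ dyadicDescendants p.1)), f x.2.1 :=
          (ENNReal.tsum_sigma' (fun x : (Σ p : M, ↥(S ∩ dyadicDescendants p.1)) => f x.2.1)).symm
      _ ≤ _ := by
          refine ENNReal.tsum_comp_le_tsum_of_injective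
            (f := fun x : (Σ p : M, ↥(S ∩ dyadicDescendants p.1)) => (⟨x.2.1, x.2.2.1⟩ : S)) ?_
            (fun q : S => f q)
          rintro ⟨⟨p, hp⟩, ⟨q, hq⟩⟩ ⟨⟨p', hp'⟩, ⟨q', hq'⟩⟩ h
          simp only [Subtype.mk.injEq] at h
          subst h
          have h1 : p.1 = p'.1 :=
            le_antisymm (key p' hp' p hp q hq'.2 hq.2) (key p hp p' hp' q hq.2 hq'.2)
          have h2 : p = p' := Prod.ext h1 (by rw [← hq.2.2, ← hq'.2.2, h1])
          subst h2
          rfl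
  · exact fun p hp => ⟨hp.1, fun m hm =>
      ⟨fun h => hp.2 m hm (bad_of_mem _ h), not_lt.1 (hp.2 m hm)⟩⟩

namespace Cube

variable {d : ℕ}

/-- The side length of the cells of generation `n`. -/
def cellSide (Q : Cube d) (n : ℕ) : ℝ := Q.side * (2 : ℝ)⁻¹ ^ n

lemma cellSide_pos (Q : Cube d) (n : ℕ) : 0 < Q.cellSide n := by
  have := Q.side_pos
  unfold cellSide
  positivity

/-- The index of the cell of generation `n` containing `x`. -/
def cellIndex (Q : Cube d) (n : ℕ) (x : Euc d) : Fin d → ℤ :=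
  fun i => ⌊(x i - Q.corner i) / Q.cellSide n⌋

/-- The dyadic cell with index `p`. -/
def cell (Q : Cube d) (p : ℕ × (Fin d → ℤ)) : Cube d where
  corner := fun i => Q.corner i + p.2 i * Q.cellSide p.1
  side := Q.cellSide p.1
  side_pos := Q.cellSide_pos p.1

lemma mem_cell_set {Q : Cube d} {p : ℕ × (Fin d → ℤ)} {x : Euc d} :
    x ∈ (Q.cell p).set ↔ Q.cellIndex p.1 x = p.2 := by
  have hs := Q.cellSide_pos p.1
  simp only [Cube.set, cell, cellIndex, funext_iff, Int.floor_eq_iff, mem_ofPred_eq,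
    le_div_iff₀ hs, div_lt_iff₀ hs, add_mul, one_mul]
  refine forall_congr' fun i => ?_
  constructor <;> rintro ⟨h1, h2⟩ <;> constructor <;> linarith

lemma cellIndex_zero_eq_zero_iff {Q : Cube d} {x : Euc d} :
    Q.cellIndex 0 x = 0 ↔ x ∈ Q.set := by
  rw [← mem_cell_set (p := (0, 0))]
  simp [Cube.set, cell, cellSide]

lemma dyadicAncestor_cellIndex (Q : Cube d) (x : Euc d) {m n : ℕ} (h : m ≤ n) :
    dyadicAncestor (n, Q.cellIndex n x) m = Q.cellIndex m x := by
  ext i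
  simp only [dyadicAncestor, cellIndex]
  rw [← Int.floor_div_natCast, div_div]
  congr 2
  obtain ⟨k, rfl⟩ := Nat.exists_eq_add_of_le h
  simp only [cellSide, add_tsub_cancel_left, pow_add]
  push_cast
  rw [inv_pow, inv_pow]
  field_simp

lemma exists_cell_cover_ball (Q : Cube d) {β : ℝ} (hβ : 0 < β) (E : Set (Euc d)) (y : Euc d)
    {r : ℝ} (hr : 2 * r ≤ Q.side) :
    ∃ S : Set (ℕ × (Fin d → ℤ)),
      (∀ x ∈ E ∩ Metric.ball y r, ∃ n, (n, Q.cellIndex n x) ∈ S) ∧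
      (∀ q ∈ S, ∃ x ∈ E, Q.cellIndex q.1 x = q.2) ∧
      ∑' q : S, ENNReal.ofReal ((Q.cell q).side ^ β) ≤
        ENNReal.ofReal (2 ^ d * 4 ^ β * r ^ β) := by
  rcases le_or_gt r 0 with h0 | h0
  · exact ⟨∅, by simp [Metric.ball_eq_empty.2 h0], by simp, by simp⟩
  have hl := Q.side_pos
  obtain ⟨n, hn1, hn2⟩ := exists_nat_pow_near_of_lt_one (x := 2 * r / Q.side) (y := (2 : ℝ)⁻¹)
    (by positivity) ((div_le_one hl).2 hr) (by norm_num) (by norm_num)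
  have hs1 : 2 * r ≤ Q.cellSide n := by
    rw [div_le_iff₀ hl] at hn2
    unfold cellSide; linarith
  have hs2 : Q.cellSide n ≤ 4 * r := by
    rw [lt_div_iff₀ hl, pow_succ] at hn1
    unfold cellSide; linarith
  have hs := Q.cellSide_pos n
  let g : (Fin d → Bool) → ℕ × (Fin d → ℤ) := fun b =>
    (n, fun i => ⌊((if b i then y i + r else y i - r) - Q.corner i) / Q.cellSide n⌋)
  let S : Set (ℕ × (Fin d → ℤ)) := (fun x => (n, Q.cellIndex n x)) '' (E ∩ Metric.ball y r)
  have hSg : S ⊆ Set.range g := by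
    rintro _ ⟨x, hx, rfl⟩
    have hpt : ∀ i, ∃ b : Bool,
        ⌊((if b then y i + r else y i - r) - Q.corner i) / Q.cellSide n⌋ =
          Q.cellIndex n x i := by
      intro i
      have h1 : |x i - y i| < r := by
        have := PiLp.norm_apply_le (x - y) i
        have hx2 := hx.2
        rw [mem_ball_iff_norm] at hx2
        simpa using this.trans_lt hx2
      rw [abs_lt] at h1
      have hlo : ⌊(y i - r - Q.corner i) / Q.cellSide n⌋ ≤ Q.cellIndex n x i :=
        Int.floor_le_floor (by gcongr; linarith)
      have hhi : Q.cellIndex n x i ≤ ⌊(y i + r - Q.corner i) / Q.cellSide n⌋ :=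
        Int.floor_le_floor (by gcongr; linarith)
      have hstep : ⌊(y i + r - Q.corner i) / Q.cellSide n⌋ ≤
          ⌊(y i - r - Q.corner i) / Q.cellSide n⌋ + 1 := by
        rw [← Int.floor_add_one]
        refine Int.floor_le_floor ?_
        rw [div_add_one hs.ne']
        gcongr
        linarith
      by_cases h : Q.cellIndex n x i = ⌊(y i + r - Q.corner i) / Q.cellSide n⌋
      · exact ⟨true, by simp [h]⟩
      · exact ⟨false, by simp only [Bool.false_eq_true, if_false]; omega⟩
    choose b hb using hpt
    exact ⟨b, Prod.ext rfl (funext hb)⟩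
  refine ⟨S, fun x hx => ⟨n, x, hx, rfl⟩, ?_, ?_⟩
  · rintro _ ⟨x, hx, rfl⟩
    exact ⟨x, hx.1, rfl⟩
  · calc ∑' q : S, ENNReal.ofReal ((Q.cell q).side ^ β)
        ≤ ∑' q : Set.range g, ENNReal.ofReal ((Q.cell q).side ^ β) :=
          ENNReal.tsum_mono_subtype (fun q => ENNReal.ofReal ((Q.cell q).side ^ β)) hSg
      _ ≤ ∑' b, ENNReal.ofReal ((Q.cell (g b)).side ^ β) :=
          ENNReal.tsum_le_tsum_comp_of_surjective
            (f := Set.rangeFactorization g) Set.rangeFactorization_surjective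
            (fun q : Set.range g => ENNReal.ofReal ((Q.cell q).side ^ β))
      _ = ENNReal.ofReal (2 ^ d * Q.cellSide n ^ β) := by
          rw [ENNReal.ofReal_mul (by positivity)]
          simp [tsum_fintype, cell, g]
      _ ≤ _ := by
          refine ENNReal.ofReal_le_ofReal ?_
          rw [mul_assoc, ← Real.mul_rpow (by norm_num) h0.le]
          gcongr

lemma exists_cell_cover (Q : Cube d) {β : ℝ} (hβ : 0 < β) {E : Set (Euc d)} {ε : ℝ}
    (hε : 0 < ε) (hε1 : ε ≤ 1)
    (h : hausdorffContent d β E <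
      ENNReal.ofReal (ballConst β / (2 ^ d * 4 ^ β) * (ε * Q.side ^ β))) :
    ∃ S : Set (ℕ × (Fin d → ℤ)),
      (∀ x ∈ E, ∃ n, (n, Q.cellIndex n x) ∈ S) ∧
      (∀ q ∈ S, ∃ x ∈ E, Q.cellIndex q.1 x = q.2) ∧
      ∑' q : S, ENNReal.ofReal ((Q.cell q).side ^ β) ≤ ENNReal.ofReal (ε * Q.side ^ β) := by
  have hω := ballConst_pos hβ
  have hl := Q.side_pos
  obtain ⟨c, hc, hsum⟩ := exists_ball_cover_of_hausdorffContent_lt h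
  have hr : ∀ j, 2 * (c j).2 ≤ Q.side := by
    intro j
    rcases le_or_gt (c j).2 0 with h0 | h0
    · linarith
    have h1 := (ENNReal.le_tsum j).trans_lt hsum
    have h2 := (ENNReal.ofReal_lt_ofReal_iff (by positivity)).1 h1
    have h3 : (4 * (c j).2) ^ β < Q.side ^ β := by
      rw [Real.mul_rpow (by norm_num) h0.le]
      have h4 : ballConst β / (2 ^ d * 4 ^ β) * (ε * Q.side ^ β) ≤
          ballConst β / (1 * 4 ^ β) * (1 * Q.side ^ β) := by
        gcongr
        exact one_le_pow₀ one_le_two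
      have h5 := h2.trans_le h4
      rw [one_mul, one_mul, div_mul_eq_mul_div, lt_div_iff₀ (by positivity)] at h5
      have h6 : ballConst β * (4 ^ β * (c j).2 ^ β) < ballConst β * Q.side ^ β := by linarith
      exact lt_of_mul_lt_mul_left h6 hω.le
    have := (Real.rpow_lt_rpow_iff (by positivity) hl.le hβ).1 h3
    linarith
  choose S hS1 hS2 hS3 using fun j => Q.exists_cell_cover_ball hβ E (c j).1 (hr j)
  refine ⟨⋃ j, S j, ?_, ?_, ?_⟩
  · intro x hx
    obtain ⟨j, hj⟩ := mem_iUnion.1 (hc hx)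
    obtain ⟨n, hn⟩ := hS1 j x ⟨hx, hj⟩
    exact ⟨n, mem_iUnion.2 ⟨j, hn⟩⟩
  · intro q hq
    obtain ⟨j, hj⟩ := mem_iUnion.1 hq
    exact hS2 j q hj
  · have hK : (0 : ℝ) < 2 ^ d * 4 ^ β / ballConst β := by positivity
    calc _ ≤ ∑' j, ∑' q : S j, ENNReal.ofReal ((Q.cell q).side ^ β) :=
          ENNReal.tsum_iUnion_le_tsum (fun q => ENNReal.ofReal ((Q.cell q).side ^ β)) S
      _ ≤ ∑' j, ENNReal.ofReal (2 ^ d * 4 ^ β / ballConst β) *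
            ENNReal.ofReal (ballConst β * (c j).2 ^ β) := by
          refine ENNReal.tsum_le_tsum fun j => (hS3 j).trans_eq ?_
          rw [← ENNReal.ofReal_mul hK.le]
          congr 1
          field_simp
      _ ≤ ENNReal.ofReal (2 ^ d * 4 ^ β / ballConst β) *
            ENNReal.ofReal (ballConst β / (2 ^ d * 4 ^ β) * (ε * Q.side ^ β)) := by
          rw [ENNReal.tsum_mul_left]
          gcongr
      _ = _ := by
          rw [← ENNReal.ofReal_mul hK.le]
          congr 1
          field_simp

lemma exists_stopping_cells (Q : Cube d) {β : ℝ} (hβ : 0 < β) {E : Set (Euc d)}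
    (hE : E ⊆ Q.set) {δ : ℝ} (hδ : 0 < δ) (hδ1 : δ < 1)
    (h : hausdorffContent d β E <
      ENNReal.ofReal (ballConst β / (2 ^ d * 4 ^ β) * (δ / 2 * Q.side ^ β))) :
    ∃ M : Set (ℕ × (Fin d → ℤ)),
      (E ⊆ ⋃ p : M, (Q.cell p).set) ∧
      (∀ p ∈ M, (Q.cell p).set ⊆ Q.set) ∧
      ∑' p : M, ENNReal.ofReal ((Q.cell p).side ^ β) ≤ ENNReal.ofReal (Q.side ^ β / 2) ∧
      ∀ p ∈ M, hausdorffContent d β (E ∩ (Q.cell p).set) ≤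
        ENNReal.ofReal (ballConst β * (d + 1) ^ β * (δ * 2 ^ β) * (Q.cell p).side ^ β) := by
  have hω := ballConst_pos hβ
  have hl := Q.side_pos
  obtain ⟨S, hS1, hS2, hS3⟩ := Q.exists_cell_cover hβ (by positivity) (by linarith) h
  set f : ℕ × (Fin d → ℤ) → ℝ≥0∞ := fun q => ENNReal.ofReal ((Q.cell q).side ^ β) with hf
  have hf0 : ∀ p, f p ≠ 0 := fun p =>
    (ENNReal.ofReal_pos.2 (Real.rpow_pos_of_pos (Q.cell p).side_pos _)).ne'
  obtain ⟨M, hM1, hM2, hM3⟩ := exists_maximal_heavy_nodes S hf0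
    (fun _ => ENNReal.ofReal_ne_top) (δ := ENNReal.ofReal δ) (by simpa using hδ1)
  have hMrep : ∀ p ∈ M, ∃ x ∈ E, Q.cellIndex p.1 x = p.2 := by
    intro p hp
    have hpos := (zero_le (a := ENNReal.ofReal δ * f p)).trans_lt (hM3 p hp).1
    obtain ⟨q, hqS, hq⟩ : (S ∩ dyadicDescendants p).Nonempty := by
      by_contra hne
      rw [Set.not_nonempty_iff_eq_empty] at hne
      rw [hne] at hpos
      simp at hpos
    obtain ⟨x, hx, hxq⟩ := hS2 q hqS
    refine ⟨x, hx, ?_⟩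
    rw [← hq.2, ← Q.dyadicAncestor_cellIndex x hq.1, hxq]
  refine ⟨M, ?_, ?_, ?_, ?_⟩
  · intro x hx
    obtain ⟨n, hn⟩ := hS1 x hx
    obtain ⟨p, hp, hpn, hpa⟩ := hM1 _ hn
    refine mem_iUnion.2 ⟨⟨p, hp⟩, mem_cell_set.2 ?_⟩
    rw [← hpa, Q.dyadicAncestor_cellIndex x hpn]
  · intro p hp y hy
    obtain ⟨x, hx, hxp⟩ := hMrep p hp
    rw [mem_cell_set] at hy
    rw [← cellIndex_zero_eq_zero_iff, ← Q.dyadicAncestor_cellIndex y (Nat.zero_le p.1), hy,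
      ← hxp, Q.dyadicAncestor_cellIndex x (Nat.zero_le p.1), cellIndex_zero_eq_zero_iff]
    exact hE hx
  · refine (ENNReal.mul_le_mul_iff_right (ENNReal.ofReal_pos.2 hδ).ne'
      ENNReal.ofReal_ne_top).1 ((hM2.trans hS3).trans_eq ?_)
    rw [← ENNReal.ofReal_mul hδ.le]
    congr 1
    ring
  · intro p hp
    have hp0 : p.1 ≠ 0 := by
      intro h0
      have hside : (Q.cell p).side = Q.side := by simp [cell, cellSide, h0]
      have h1 : ENNReal.ofReal δ * f p < ENNReal.ofReal (δ / 2 * Q.side ^ β) :=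
        (hM3 p hp).1.trans_le
          ((ENNReal.tsum_mono_subtype f Set.inter_subset_left).trans hS3)
      simp only [hf, hside] at h1
      rw [← ENNReal.ofReal_mul hδ.le] at h1
      have h2 := (ENNReal.ofReal_lt_ofReal_iff (by positivity)).1 h1
      have : 0 < δ * Q.side ^ β := by positivity
      linarith
    have hlt : p.1 - 1 < p.1 := by omega
    obtain ⟨-, hsum⟩ := (hM3 p hp).2 (p.1 - 1) hlt
    have hanc : ∀ m < p.1, (m, dyadicAncestor p m) ∉ S := fun m hm => ((hM3 p hp).2 m hm).1
    set p' : ℕ × (Fin d → ℤ) := (p.1 - 1, dyadicAncestor p (p.1 - 1)) with hp'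
    have hcov : E ∩ (Q.cell p).set ⊆ ⋃ q : ↥(S ∩ dyadicDescendants p'), (Q.cell q).set := by
      rintro x ⟨hxE, hxp⟩
      rw [mem_cell_set] at hxp
      have hpx : p = (p.1, Q.cellIndex p.1 x) := Prod.ext rfl hxp.symm
      obtain ⟨n, hn⟩ := hS1 x hxE
      have hnp : p.1 ≤ n := by
        by_contra! hnp
        refine hanc n hnp ?_
        rw [hpx, Q.dyadicAncestor_cellIndex x hnp.le]
        exact hn
      refine mem_iUnion.2 ⟨⟨(n, Q.cellIndex n x), hn, hlt.le.trans hnp, ?_⟩, mem_cell_set.2 rfl⟩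
      rw [hp', Q.dyadicAncestor_cellIndex x (hlt.le.trans hnp), hpx]
      exact (Q.dyadicAncestor_cellIndex x hlt.le).symm
    have hside : (Q.cell p').side = 2 * (Q.cell p).side := by
      obtain ⟨k, hk⟩ := Nat.exists_eq_succ_of_ne_zero hp0
      simp only [cell, cellSide, hp', hk, Nat.succ_eq_add_one, add_tsub_cancel_right, pow_succ]
      ring
    have hC : 0 ≤ ballConst β * (d + 1 : ℝ) ^ β := by positivity
    calc hausdorffContent d β (E ∩ (Q.cell p).set)
        ≤ ∑' q : ↥(S ∩ dyadicDescendants p'), hausdorffContent d β (Q.cell q).set :=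
          (hausdorffContent_mono hcov).trans (hausdorffContent_iUnion_le hβ _)
      _ ≤ ∑' q : ↥(S ∩ dyadicDescendants p'),
            ENNReal.ofReal (ballConst β * (d + 1 : ℝ) ^ β) * f q :=
          ENNReal.tsum_le_tsum fun q => by
            rw [hf, ← ENNReal.ofReal_mul hC]
            exact (Q.cell q).hausdorffContent_set_le hβ
      _ ≤ ENNReal.ofReal (ballConst β * (d + 1 : ℝ) ^ β) * (ENNReal.ofReal δ * f p') := by
          rw [ENNReal.tsum_mul_left]
          gcongr
      _ = _ := by
          rw [hf, ← ENNReal.ofReal_mul hδ.le, ← ENNReal.ofReal_mul hC, hside,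
            Real.mul_rpow (by norm_num) (Q.cell p).side_pos.le]
          congr 1
          ring

end Cube

lemma exists_weak_type_const {d : ℕ} {β : ℝ} {Q₀ : Set (Euc d)} {u : Euc d → ℝ} {B : ℝ}
    (hB : 0 < B) (hu : bmoSeminorm d β Q₀ u = ENNReal.ofReal B) (Q : Cube d) (hQ : Q.set ⊆ Q₀) :
    ∃ c : ℝ, ∀ s : ℝ, 0 < s →
      hausdorffContent d β {x ∈ Q.set | s < |u x - c|} ≤
        ENNReal.ofReal (2 * B / s * Q.side ^ β) := by
  have hl : 0 < Q.side ^ β := Real.rpow_pos_of_pos Q.side_pos _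
  have h1 : ⨅ c : ℝ, choquetIntegral (hausdorffContent d β) Q.set (fun x => |u x - c|) /
      ENNReal.ofReal (Q.side ^ β) < ENNReal.ofReal (2 * B) := by
    refine lt_of_le_of_lt ?_ ((ENNReal.ofReal_lt_ofReal_iff (by linarith)).2
      (by linarith : B < 2 * B))
    rw [← hu]
    exact le_iSup₂ (f := fun (Q : Cube d) (_ : Q.set ⊆ Q₀) =>
      ⨅ c : ℝ, choquetIntegral (hausdorffContent d β) Q.set (fun x => |u x - c|) /
        ENNReal.ofReal (Q.side ^ β)) Q hQ
  obtain ⟨c, hc⟩ := iInf_lt_iff.1 h1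
  refine ⟨c, fun s hs => ?_⟩
  have h2 := mul_hausdorffContent_le_choquetIntegral (β := β) Q.set (fun x => |u x - c|) s
  have h3 := (ENNReal.div_le_iff (ENNReal.ofReal_pos.2 hl).ne' ENNReal.ofReal_ne_top).1 hc.le
  refine (ENNReal.mul_le_mul_iff_right (ENNReal.ofReal_pos.2 hs).ne'
    ENNReal.ofReal_ne_top).1 ((h2.trans h3).trans_eq ?_)
  rw [← ENNReal.ofReal_mul (by positivity), ← ENNReal.ofReal_mul hs.le]
  congr 1
  field_simp

/-- The density threshold of the stopping-time argument. -/
def stoppingDensity (d : ℕ) (β : ℝ) : ℝ := (4 * 2 ^ d * (d + 1) ^ β * 2 ^ β)⁻¹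

/-- The smallness required of the weak-type bound in the stopping-time argument. -/
def stoppingSmallness (d : ℕ) (β : ℝ) : ℝ :=
  ballConst β / (2 ^ d * 4 ^ β) * (stoppingDensity d β / 4)

lemma stoppingDensity_pos (d : ℕ) (β : ℝ) : 0 < stoppingDensity d β := by
  unfold stoppingDensity; positivity

lemma stoppingDensity_lt_one (d : ℕ) {β : ℝ} (hβ : 0 < β) : stoppingDensity d β < 1 := by
  refine inv_lt_one_of_one_lt₀ ?_
  have h1 : (1 : ℝ) ≤ 2 ^ d := one_le_pow₀ one_le_two
  have h2 : (1 : ℝ) ≤ (d + 1 : ℝ) ^ β :=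
    Real.one_le_rpow (by linarith [d.cast_nonneg (α := ℝ)]) hβ.le
  have h3 : (1 : ℝ) ≤ 2 ^ β := Real.one_le_rpow one_le_two hβ.le
  calc (1 : ℝ) < 4 * 1 * 1 * 1 := by norm_num
    _ ≤ _ := by gcongr

lemma stoppingSmallness_pos (d : ℕ) {β : ℝ} (hβ : 0 < β) : 0 < stoppingSmallness d β := by
  have := ballConst_pos hβ
  have := stoppingDensity_pos d β
  unfold stoppingSmallness; positivity

lemma stoppingSmallness_le (d : ℕ) {β : ℝ} (hβ : 0 < β) :
    stoppingSmallness d β ≤ ballConst β / 2 ^ d / 4 := by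
  have hω := ballConst_pos hβ
  have h3 : (1 : ℝ) ≤ 4 ^ β := Real.one_le_rpow (by norm_num) hβ.le
  have h4 := (stoppingDensity_lt_one d hβ).le
  have h5 := stoppingDensity_pos d β
  calc stoppingSmallness d β ≤ ballConst β / (2 ^ d * 1) * (1 / 4) := by
        unfold stoppingSmallness; gcongr
    _ = _ := by ring

lemma hausdorffContent_superlevel_le_geometric {d : ℕ} {β : ℝ} (hβ : 0 < β) (hβd : β ≤ d)
    {Q₀ : Set (Euc d)} {u : Euc d → ℝ} {c : Cube d → ℝ} {τ : ℝ}
    (hc : ∀ Q : Cube d, Q.set ⊆ Q₀ →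
      hausdorffContent d β {x ∈ Q.set | τ < |u x - c Q|} ≤
        ENNReal.ofReal (stoppingSmallness d β * Q.side ^ β)) (hτ : 0 ≤ τ) (m : ℕ) :
    ∀ Q : Cube d, Q.set ⊆ Q₀ → ∀ t : ℝ, m * (2 * τ) ≤ t →
      hausdorffContent d β {x ∈ Q.set | t < |u x - c Q|} ≤
        ENNReal.ofReal (ballConst β * (d + 1 : ℝ) ^ β * (1 / 2) ^ m * Q.side ^ β) := by
  have hω := ballConst_pos hβ
  have hδ := stoppingDensity_pos d β
  have hη := stoppingSmallness_pos d hβ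
  induction m with
  | zero =>
    intro Q _ t _
    rw [pow_zero, mul_one]
    exact (hausdorffContent_mono fun x hx => hx.1).trans (Q.hausdorffContent_set_le hβ)
  | succ m ih =>
    intro Q hQ t ht
    have hlQ : 0 < Q.side ^ β := Real.rpow_pos_of_pos Q.side_pos _
    push_cast at ht
    have hm : (0 : ℝ) ≤ m * (2 * τ) := by positivity
    set E : Set (Euc d) := {x ∈ Q.set | τ < |u x - c Q|} with hE
    obtain ⟨M, hM1, hM2, hM3, hM4⟩ := Q.exists_stopping_cells hβ (E := E) (fun x hx => hx.1) hδ
      (stoppingDensity_lt_one d hβ) ((hc Q hQ).trans_lt (by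
        refine (ENNReal.ofReal_lt_ofReal_iff (by positivity)).2 ?_
        have : 0 < stoppingSmallness d β * Q.side ^ β := by positivity
        calc stoppingSmallness d β * Q.side ^ β < 2 * (stoppingSmallness d β * Q.side ^ β) := by
              linarith
          _ = _ := by unfold stoppingSmallness; ring))
    have hclose : ∀ p ∈ M, |c (Q.cell p) - c Q| ≤ 2 * τ := by
      intro p hp
      by_contra! hfar
      have hl : 0 < (Q.cell p).side ^ β := Real.rpow_pos_of_pos (Q.cell p).side_pos _
      have hsub : (Q.cell p).set ⊆ (E ∩ (Q.cell p).set) ∪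
          {x ∈ (Q.cell p).set | τ < |u x - c (Q.cell p)|} := by
        intro x hx
        by_cases h1 : τ < |u x - c Q|
        · exact Or.inl ⟨⟨hM2 p hp hx, h1⟩, hx⟩
        · refine Or.inr ⟨hx, ?_⟩
          by_contra! h2
          have h3 := abs_sub_le (c (Q.cell p)) (u x) (c Q)
          rw [abs_sub_comm (c (Q.cell p)) (u x)] at h3
          linarith
      have h1 := ((Q.cell p).le_hausdorffContent_set hβ hβd).trans
        ((hausdorffContent_mono hsub).trans ((hausdorffContent_union_le hβ _ _).trans
          (add_le_add (hM4 p hp) (hc _ ((hM2 p hp).trans hQ)))))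
      rw [← ENNReal.ofReal_add (by positivity) (by positivity),
        ENNReal.ofReal_le_ofReal_iff (by positivity)] at h1
      have h2 : ballConst β * (d + 1 : ℝ) ^ β * (stoppingDensity d β * 2 ^ β) =
          ballConst β / 2 ^ d / 4 := by
        unfold stoppingDensity
        field_simp
      rw [h2, ← add_mul] at h1
      have h3 := le_of_mul_le_mul_right h1 hl
      have h4 := stoppingSmallness_le d hβ
      have h5 : 0 < ballConst β / 2 ^ d := by positivity
      linarith
    have hsub : {x ∈ Q.set | t < |u x - c Q|} ⊆
        ⋃ p : M, {x ∈ (Q.cell p).set | t - 2 * τ < |u x - c (Q.cell p)|} := by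
      intro x hx
      have hxE : x ∈ E := ⟨hx.1, by linarith [hx.2]⟩
      obtain ⟨p, hp⟩ := mem_iUnion.1 (hM1 hxE)
      refine mem_iUnion.2 ⟨p, hp, ?_⟩
      have h1 := abs_sub_le (u x) (c (Q.cell p)) (c Q)
      linarith [hclose p p.2, hx.2]
    have hK : 0 ≤ ballConst β * (d + 1 : ℝ) ^ β * (1 / 2) ^ m := by positivity
    calc _ ≤ ∑' p : M, hausdorffContent d β
            {x ∈ (Q.cell p).set | t - 2 * τ < |u x - c (Q.cell p)|} :=
          (hausdorffContent_mono hsub).trans (hausdorffContent_iUnion_le hβ _)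
      _ ≤ ∑' p : M, ENNReal.ofReal (ballConst β * (d + 1 : ℝ) ^ β * (1 / 2) ^ m) *
            ENNReal.ofReal ((Q.cell p).side ^ β) :=
          ENNReal.tsum_le_tsum fun p => by
            rw [← ENNReal.ofReal_mul hK]
            exact ih _ ((hM2 p p.2).trans hQ) _ (by linarith)
      _ ≤ ENNReal.ofReal (ballConst β * (d + 1 : ℝ) ^ β * (1 / 2) ^ m) *
            ENNReal.ofReal (Q.side ^ β / 2) := by
          rw [ENNReal.tsum_mul_left]
          gcongr
      _ = _ := by
          rw [← ENNReal.ofReal_mul hK]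
          congr 1
          ring

lemma half_pow_floor_le {t A : ℝ} :
    (1 / 2 : ℝ) ^ ⌊t / A⌋₊ ≤ 2 * Real.exp (-Real.log 2 * (t / A)) := by
  have h1 : t / A - 1 ≤ ⌊t / A⌋₊ := (Nat.sub_one_lt_floor _).le
  have hlog : 0 < Real.log 2 := Real.log_pos one_lt_two
  calc (1 / 2 : ℝ) ^ ⌊t / A⌋₊ = Real.exp (-Real.log 2 * ⌊t / A⌋₊) := by
        rw [mul_comm, Real.exp_nat_mul, Real.exp_neg, Real.exp_log two_pos, one_div]
    _ ≤ Real.exp (Real.log 2 + -Real.log 2 * (t / A)) := by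
        refine Real.exp_le_exp.2 ?_
        nlinarith
    _ = _ := by rw [Real.exp_add, Real.exp_log two_pos]

theorem john_nirenberg_content (d : ℕ) (hd : 1 ≤ d) (β : ℝ) (hβ : 0 < β) (hβd : β ≤ (d : ℝ))
    (Q₀ : Cube d) :
    ∃ c C : ℝ, 0 < c ∧ 0 < C ∧
      ∀ u : Euc d → ℝ, MemBMO d β Q₀.set u → 0 < bmoSeminorm d β Q₀.set u →
        ∀ Q : Cube d, Q.set ⊆ Q₀.set →
          ∃ cQ : ℝ, ∀ t : ℝ, 0 < t →
            hausdorffContent d β {x ∈ Q.set | t < |u x - cQ|} ≤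
              ENNReal.ofReal (C * Q.side ^ β *
                Real.exp (-c * t / (bmoSeminorm d β Q₀.set u).toReal)) := by
  have hω := ballConst_pos hβ
  have hη := stoppingSmallness_pos d hβ
  have hlog : 0 < Real.log 2 := Real.log_pos one_lt_two
  refine ⟨Real.log 2 * stoppingSmallness d β / 4, 2 * (ballConst β * (d + 1 : ℝ) ^ β),
    by positivity, by positivity, ?_⟩
  intro u hu hpos Q hQ
  set B := (bmoSeminorm d β Q₀.set u).toReal with hBdef
  have hB : 0 < B := ENNReal.toReal_pos hpos.ne' hu.2.ne
  have huB : bmoSeminorm d β Q₀.set u = ENNReal.ofReal B := (ENNReal.ofReal_toReal hu.2.ne).symm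
  choose! c hc using exists_weak_type_const hB huB
  set τ := 2 * B / stoppingSmallness d β with hτdef
  have hτ : 0 < τ := by positivity
  have hcτ : ∀ Q : Cube d, Q.set ⊆ Q₀.set →
      hausdorffContent d β {x ∈ Q.set | τ < |u x - c Q|} ≤
        ENNReal.ofReal (stoppingSmallness d β * Q.side ^ β) := by
    intro Q hQ
    refine (hc Q hQ τ hτ).trans_eq ?_
    rw [hτdef]
    congr 2
    field_simp
  refine ⟨c Q, fun t ht => ?_⟩
  have hlQ : 0 < Q.side ^ β := Real.rpow_pos_of_pos Q.side_pos _
  have hfloor : (⌊t / (2 * τ)⌋₊ : ℝ) * (2 * τ) ≤ t :=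
    (le_div_iff₀ (by positivity)).1 (Nat.floor_le (by positivity))
  refine (hausdorffContent_superlevel_le_geometric hβ hβd hcτ hτ.le _ Q hQ t hfloor).trans
    (ENNReal.ofReal_le_ofReal ?_)
  calc _ ≤ ballConst β * (d + 1 : ℝ) ^ β *
        (2 * Real.exp (-Real.log 2 * (t / (2 * τ)))) * Q.side ^ β := by
        gcongr
        exact half_pow_floor_le
    _ = 2 * (ballConst β * (d + 1 : ℝ) ^ β) * Q.side ^ β *
        Real.exp (-Real.log 2 * (t / (2 * τ))) := by ring
    _ = _ := by
        congr 2
        rw [hτdef]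
        field_simp
        ring

end
end

section
/- Let d ≥ 1, β ∈ (0,d], and let Q ⊂ ℝ^d be a cube. The dyadic Hausdorff content adapted to Q is continuous from below: for every increasing sequence of arbitrary sets E₁ ⊂ E₂ ⊂ ⋯ ⊂ ℝ^d with E = ∪_{n} E_n, one has 𝓗^{β,Q}_∞(E) = lim_{n→∞} 𝓗^{β,Q}_∞(E_n). -/
open Set MeasureTheory ENNReal NNReal Filter

noncomputable section

/-- A weighted family of sets in which two sets that meet are nested according to their level,
distinct sets of the same level are disjoint, and the weight controls the level from above. -/
structure NetFamily (ι X : Type*) where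
  carrier : ι → Set X
  level : ι → ℤ
  weight : ι → ℝ≥0∞
  nested : ∀ a b, level a ≤ level b → (carrier a ∩ carrier b).Nonempty → carrier a ⊆ carrier b
  eq_of_level_eq : ∀ a b, level a = level b → (carrier a ∩ carrier b).Nonempty → a = b
  bddAbove_level : ∀ K : ℝ≥0∞, K ≠ ⊤ → BddAbove (level '' {a | weight a ≤ K})

namespace NetFamily

variable {ι X : Type*} (𝓕 : NetFamily ι X)

/-- The union of the members of the family with index in `F`. -/
def cover (F : Set ι) : Set X := ⋃ a ∈ F, 𝓕.carrier a

/-- The total weight of the members of the family with index in `F`. -/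
def mass (F : Set ι) : ℝ≥0∞ := ∑' a, F.indicator 𝓕.weight a

/-- The least total weight of a cover of `E` by members of the family. -/
def content (E : Set X) : ℝ≥0∞ := ⨅ (F : Set ι) (_ : E ⊆ 𝓕.cover F), 𝓕.mass F

/-- The indices in `F` that are maximal with respect to inclusion. -/
def maximals (F : Set ι) : Set ι :=
  {a ∈ F | ∀ b ∈ F, 𝓕.level a ≤ 𝓕.level b → 𝓕.carrier a ⊆ 𝓕.carrier b → b = a}

lemma mem_cover {F : Set ι} {x : X} : x ∈ 𝓕.cover F ↔ ∃ a ∈ F, x ∈ 𝓕.carrier a := by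
  simp [cover]

lemma content_le {E : Set X} {F : Set ι} (h : E ⊆ 𝓕.cover F) : 𝓕.content E ≤ 𝓕.mass F :=
  iInf₂_le F h

lemma content_mono : Monotone 𝓕.content := fun _ _ h =>
  le_iInf₂ fun _ hF => 𝓕.content_le (h.trans hF)

lemma exists_cover_mass_le {E : Set X} (hE : 𝓕.content E ≠ ⊤) {ε : ℝ≥0∞} (hε : ε ≠ 0) :
    ∃ F, E ⊆ 𝓕.cover F ∧ 𝓕.mass F ≤ 𝓕.content E + ε := by
  have h : 𝓕.content E < 𝓕.content E + ε := ENNReal.lt_add_right hE hε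
  obtain ⟨F, hF⟩ := iInf_lt_iff.1 h
  obtain ⟨hEF, hF⟩ := iInf_lt_iff.1 hF
  exact ⟨F, hEF, hF.le⟩

lemma weight_le_mass {F : Set ι} {a : ι} (ha : a ∈ F) : 𝓕.weight a ≤ 𝓕.mass F := by
  simpa [ha, mass] using ENNReal.le_tsum (f := F.indicator 𝓕.weight) a

lemma maximals_subset (F : Set ι) : 𝓕.maximals F ⊆ F := fun _ h => h.1

lemma cover_maximals {F : Set ι} (hF : BddAbove (𝓕.level '' F)) :
    𝓕.cover (𝓕.maximals F) = 𝓕.cover F := by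
  apply Subset.antisymm
  · exact biUnion_subset_biUnion_left (𝓕.maximals_subset F)
  · intro x hx
    obtain ⟨a, ha, hxa⟩ := 𝓕.mem_cover.1 hx
    obtain ⟨N, hN⟩ := hF
    obtain ⟨_, ⟨b, hb, hxb, rfl⟩, hmax⟩ := Int.exists_greatest_of_bdd
      (P := fun n => ∃ b ∈ F, x ∈ 𝓕.carrier b ∧ 𝓕.level b = n)
      ⟨N, by rintro _ ⟨b, hb, -, rfl⟩; exact hN ⟨b, hb, rfl⟩⟩ ⟨_, a, ha, hxa, rfl⟩
    refine 𝓕.mem_cover.2 ⟨b, ⟨hb, fun c hc hbc hsub => ?_⟩, hxb⟩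
    exact 𝓕.eq_of_level_eq c b (le_antisymm (hmax _ ⟨c, hc, hsub hxb, rfl⟩) hbc)
      ⟨x, hsub hxb, hxb⟩

/-- Submodularity: the maximal members of two covers together with a cover of the common part
weigh at most as much as the two covers. -/
lemma mass_maximals_union_add_content_le {E : Set X} {M C : Set ι} (hM : E ⊆ 𝓕.cover M)
    (hC : E ⊆ 𝓕.cover C) :
    𝓕.mass (𝓕.maximals (M ∪ C)) + 𝓕.content E ≤ 𝓕.mass M + 𝓕.mass C := by
  let below : Set ι → Set ι → Set ι := fun A B =>
    {a ∈ A | ∃ b ∈ B, 𝓕.level a ≤ 𝓕.level b ∧ 𝓕.carrier a ⊆ 𝓕.carrier b}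
  let N := below M C ∪ below C M
  have hN : E ⊆ 𝓕.cover N := by
    intro x hx
    obtain ⟨a, ha, hxa⟩ := 𝓕.mem_cover.1 (hM hx)
    obtain ⟨b, hb, hxb⟩ := 𝓕.mem_cover.1 (hC hx)
    rcases le_total (𝓕.level a) (𝓕.level b) with h | h
    · exact 𝓕.mem_cover.2 ⟨a, Or.inl ⟨ha, b, hb, h, 𝓕.nested a b h ⟨x, hxa, hxb⟩⟩, hxa⟩
    · exact 𝓕.mem_cover.2 ⟨b, Or.inr ⟨hb, a, ha, h, 𝓕.nested b a h ⟨x, hxb, hxa⟩⟩, hxb⟩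
  refine (add_le_add_right (𝓕.content_le hN) _).trans ?_
  simp only [mass]
  rw [← ENNReal.tsum_add, ← ENNReal.tsum_add]
  refine ENNReal.tsum_le_tsum fun a => ?_
  have hmax : a ∈ 𝓕.maximals (M ∪ C) → a ∈ M ∪ C := fun h => h.1
  have hNsub : a ∈ N → a ∈ M ∪ C := fun h => h.imp (fun h => h.1) fun h => h.1
  have hboth : a ∈ 𝓕.maximals (M ∪ C) → a ∈ N → a ∈ M ∧ a ∈ C := by
    rintro ⟨-, h⟩ (⟨ha, b, hb, hl, hs⟩ | ⟨ha, b, hb, hl, hs⟩)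
    · exact ⟨ha, h b (Or.inr hb) hl hs ▸ hb⟩
    · exact ⟨h b (Or.inl hb) hl hs ▸ hb, ha⟩
  by_cases h₁ : a ∈ 𝓕.maximals (M ∪ C) <;> by_cases h₂ : a ∈ N
  · simp [h₁, h₂, hboth h₁ h₂]
  · rcases hmax h₁ with h | h <;> simp [h₁, h₂, h]
  · rcases hNsub h₂ with h | h <;> simp [h₁, h₂, h]
  · simp [h₁, h₂]

/-- The maximal members of the first `n + 1` families, formed successively. -/
def successiveMaximals (C : ℕ → Set ι) : ℕ → Set ι
  | 0 => C 0
  | n + 1 => 𝓕.maximals (successiveMaximals C n ∪ C (n + 1))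

lemma successiveMaximals_subset (C : ℕ → Set ι) (n : ℕ) :
    𝓕.successiveMaximals C n ⊆ ⋃ m, C m := by
  induction n with
  | zero => exact subset_iUnion C 0
  | succ n ih =>
    exact (𝓕.maximals_subset _).trans (union_subset ih (subset_iUnion C (n + 1)))

lemma mem_successiveMaximals {C : ℕ → Set ι} {a : ι} (ha : a ∈ 𝓕.maximals (⋃ m, C m)) {m n : ℕ}
    (hm : a ∈ C m) (hmn : m ≤ n) : a ∈ 𝓕.successiveMaximals C n := by
  have step : ∀ k, a ∈ 𝓕.successiveMaximals C k ∪ C (k + 1) →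
      a ∈ 𝓕.successiveMaximals C (k + 1) := fun k hk =>
    ⟨hk, fun b hb => ha.2 b
      (union_subset (𝓕.successiveMaximals_subset C k) (subset_iUnion C (k + 1)) hb)⟩
  induction n, hmn using Nat.le_induction with
  | base =>
    cases m with
    | zero => exact hm
    | succ k => exact step k (Or.inr hm)
  | succ n _ ih => exact step n (Or.inl ih)

lemma cover_successiveMaximals {C : ℕ → Set ι} (hC : BddAbove (𝓕.level '' ⋃ m, C m)) (n : ℕ) :
    𝓕.cover (C n) ⊆ 𝓕.cover (𝓕.successiveMaximals C n) := by
  cases n with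
  | zero => exact Subset.rfl
  | succ n =>
    rw [successiveMaximals, 𝓕.cover_maximals]
    · exact biUnion_subset_biUnion_left subset_union_right
    · exact hC.mono (image_mono
        (union_subset (𝓕.successiveMaximals_subset C n) (subset_iUnion C (n + 1))))

lemma mass_successiveMaximals_le {E : ℕ → Set X} (hE : Monotone E)
    (hfin : ∀ n, 𝓕.content (E n) ≠ ⊤) {C : ℕ → Set ι} {ε : ℕ → ℝ≥0∞}
    (hC : BddAbove (𝓕.level '' ⋃ m, C m)) (hEC : ∀ n, E n ⊆ 𝓕.cover (C n))
    (hmass : ∀ n, 𝓕.mass (C n) ≤ 𝓕.content (E n) + ε n) (n : ℕ) :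
    𝓕.mass (𝓕.successiveMaximals C n) ≤ 𝓕.content (E n) + ∑ i ∈ Finset.range (n + 1), ε i := by
  induction n with
  | zero => simpa [successiveMaximals] using hmass 0
  | succ n ih =>
    have h := 𝓕.mass_maximals_union_add_content_le
      ((hEC n).trans (𝓕.cover_successiveMaximals hC n))
      ((hE n.le_succ).trans (hEC (n + 1)))
    refine (ENNReal.add_le_add_iff_right (hfin n)).1
      (h.trans ((add_le_add ih (hmass (n + 1))).trans_eq ?_))
    rw [Finset.sum_range_succ _ (n + 1)]
    ring

theorem content_iUnion {E : ℕ → Set X} (hE : Monotone E) :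
    𝓕.content (⋃ n, E n) = ⨆ n, 𝓕.content (E n) := by
  refine le_antisymm ?_ (iSup_le fun n => 𝓕.content_mono (subset_iUnion E n))
  set L := ⨆ n, 𝓕.content (E n) with hL
  have hle : ∀ n, 𝓕.content (E n) ≤ L := le_iSup fun n => 𝓕.content (E n)
  refine ENNReal.le_of_forall_pos_le_add fun δ hδ hLtop => ?_
  have hfin : ∀ n, 𝓕.content (E n) ≠ ⊤ := fun n => ((hle n).trans_lt hLtop).ne
  obtain ⟨ε, hε, hsum⟩ :=
    ENNReal.exists_pos_sum_of_countable (ε := (δ : ℝ≥0∞)) (by simpa using hδ.ne') ℕ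
  choose C hEC hmass using fun n =>
    𝓕.exists_cover_mass_le (hfin n) (ε := (ε n : ℝ≥0∞)) (by simpa using (hε n).ne')
  have hbdd : BddAbove (𝓕.level '' ⋃ m, C m) := by
    refine (𝓕.bddAbove_level (L + δ) (by finiteness)).mono (image_mono ?_)
    refine iUnion_subset fun n a ha => (𝓕.weight_le_mass ha).trans ((hmass n).trans ?_)
    exact add_le_add (hle n) ((ENNReal.le_tsum n).trans hsum.le)
  have hcover : (⋃ n, E n) ⊆ 𝓕.cover (𝓕.maximals (⋃ m, C m)) := by
    rw [𝓕.cover_maximals hbdd]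
    exact iUnion_subset fun n =>
      (hEC n).trans (biUnion_subset_biUnion_left (subset_iUnion C n))
  refine (𝓕.content_le hcover).trans ?_
  rw [mass, ENNReal.tsum_eq_iSup_sum]
  refine iSup_le fun T => ?_
  obtain ⟨n, hn⟩ : ∃ n, ∀ a ∈ T, a ∈ 𝓕.maximals (⋃ m, C m) →
      a ∈ 𝓕.successiveMaximals C n := by
    have : ∀ a, ∃ m, a ∈ 𝓕.maximals (⋃ m, C m) → a ∈ C m := fun a => by
      by_cases ha : a ∈ 𝓕.maximals (⋃ m, C m)
      · obtain ⟨m, hm⟩ := mem_iUnion.1 ha.1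
        exact ⟨m, fun _ => hm⟩
      · exact ⟨0, fun h => absurd h ha⟩
    choose m hm using this
    exact ⟨T.sup m, fun a haT ha => 𝓕.mem_successiveMaximals ha (hm a ha) (Finset.le_sup haT)⟩
  calc ∑ a ∈ T, (𝓕.maximals (⋃ m, C m)).indicator 𝓕.weight a
      ≤ ∑ a ∈ T, (𝓕.successiveMaximals C n).indicator 𝓕.weight a := by
        refine Finset.sum_le_sum fun a haT => ?_
        by_cases ha : a ∈ 𝓕.maximals (⋃ m, C m)
        · simp [ha, hn a haT ha]
        · simp [ha]
    _ ≤ 𝓕.mass (𝓕.successiveMaximals C n) := ENNReal.sum_le_tsum T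
    _ ≤ 𝓕.content (E n) + ∑ i ∈ Finset.range (n + 1), (ε i : ℝ≥0∞) :=
        𝓕.mass_successiveMaximals_le hE hfin hbdd hEC hmass n
    _ ≤ L + δ := add_le_add (hle n) ((ENNReal.sum_le_tsum _).trans hsum.le)

end NetFamily

namespace Cube

variable {d : ℕ}

/-- The cube of `𝓓(Q)` of side `l(Q)·2ⁿ` at the grid position `k`, where `a = (n, k)`. -/
def grid (Q : Cube d) (a : ℤ × (Fin d → ℤ)) : Cube d where
  corner i := Q.corner i + (a.2 i : ℝ) * (Q.side * 2 ^ a.1)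
  side := Q.side * 2 ^ a.1
  side_pos := by have := Q.side_pos; positivity

lemma grid_mem_dyadic (Q : Cube d) (a : ℤ × (Fin d → ℤ)) : Q.grid a ∈ Q.dyadic :=
  ⟨a.1, a.2, rfl, fun _ => rfl⟩

lemma exists_eq_grid {Q Q' : Cube d} (h : Q' ∈ Q.dyadic) : ∃ a, Q' = Q.grid a := by
  obtain ⟨n, k, hs, hc⟩ := h
  refine ⟨(n, k), ?_⟩
  obtain ⟨c, s, _⟩ := Q'
  simp only [grid, mk.injEq]
  exact ⟨funext hc, hs⟩

lemma mem_grid_set {Q : Cube d} {a : ℤ × (Fin d → ℤ)} {x : Euc d} :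
    x ∈ (Q.grid a).set ↔ ∀ i, ⌊(x i - Q.corner i) / (Q.side * 2 ^ a.1)⌋ = a.2 i := by
  have hs := (Q.grid a).side_pos
  simp only [grid] at hs
  refine forall_congr' fun i => ?_
  rw [Int.floor_eq_iff, le_div_iff₀ hs, div_lt_iff₀ hs]
  simp only [grid]
  constructor <;> rintro ⟨h₁, h₂⟩ <;> constructor <;> linarith

lemma floor_grid_eq_of_le (Q : Cube d) {m n : ℤ} (h : m ≤ n) (t : ℝ) :
    ⌊t / (Q.side * 2 ^ n)⌋ = ⌊t / (Q.side * 2 ^ m)⌋ / 2 ^ (n - m).toNat := by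
  have h2 : (2 : ℝ) ^ n = 2 ^ m * ((2 ^ (n - m).toNat : ℕ) : ℝ) := by
    rw [Nat.cast_pow, Nat.cast_ofNat, ← zpow_natCast, ← zpow_add₀ two_ne_zero]
    congr 1
    omega
  have hd := Int.floor_div_natCast (t / (Q.side * 2 ^ m)) (2 ^ (n - m).toNat)
  rw [h2, ← mul_assoc, ← div_div, hd]
  push_cast
  rfl

/-- The dyadic lattice of `Q` as a weighted net of sets. -/
def net (Q : Cube d) {β : ℝ} (hβ : 0 < β) :
    NetFamily (ℤ × (Fin d → ℤ)) (Euc d) where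
  carrier a := (Q.grid a).set
  level a := a.1
  weight a := ENNReal.ofReal ((Q.grid a).side ^ β)
  nested := by
    rintro a b hab ⟨x, hxa, hxb⟩ y hy
    rw [mem_grid_set] at *
    intro i
    rw [← hxb i, Q.floor_grid_eq_of_le hab, Q.floor_grid_eq_of_le hab, hxa i, hy i]
  eq_of_level_eq := by
    rintro ⟨n, k⟩ ⟨m, l⟩ hab ⟨x, hxa, hxb⟩
    obtain rfl : n = m := hab
    rw [mem_grid_set] at *
    exact Prod.ext rfl (funext fun i => (hxa i).symm.trans (hxb i))
  bddAbove_level := by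
    intro K hK
    have hlim : Tendsto (fun n : ℕ => ENNReal.ofReal ((Q.side * 2 ^ n) ^ β)) atTop (nhds ⊤) :=
      ENNReal.tendsto_ofReal_atTop.comp <| (_root_.tendsto_rpow_atTop hβ).comp <|
        (tendsto_pow_atTop_atTop_of_one_lt _root_.one_lt_two).const_mul_atTop Q.side_pos
    obtain ⟨N, hN⟩ := (hlim.eventually (lt_mem_nhds hK.lt_top)).exists
    refine ⟨N, ?_⟩
    rintro _ ⟨a, ha, rfl⟩
    by_contra! hlt
    refine (hN.trans_le ?_).not_ge ha
    have hs := Q.side_pos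
    refine ENNReal.ofReal_le_ofReal (Real.rpow_le_rpow (by positivity) ?_ hβ.le)
    simp only [grid]
    rw [← zpow_natCast]
    gcongr
    exact one_le_two

lemma exists_small_dyadic (Q : Cube d) {β : ℝ} (hβ : 0 < β) {δ : ℝ≥0∞} (hδ : 0 < δ) :
    ∃ Q' ∈ Q.dyadic, ENNReal.ofReal (Q'.side ^ β) ≤ δ := by
  have hlim : Tendsto (fun n : ℕ => ENNReal.ofReal ((Q.side * 2⁻¹ ^ n) ^ β)) atTop (nhds 0) := by
    have h : Tendsto (fun n : ℕ => Q.side * (2⁻¹ : ℝ) ^ n) atTop (nhds 0) := by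
      simpa using (tendsto_pow_atTop_nhds_zero_of_lt_one (by norm_num : (0 : ℝ) ≤ 2⁻¹)
        (by norm_num)).const_mul Q.side
    simpa [Real.zero_rpow hβ.ne'] using ENNReal.tendsto_ofReal (h.rpow_const (Or.inr hβ.le))
  obtain ⟨n, hn⟩ := (hlim.eventually (gt_mem_nhds hδ)).exists
  refine ⟨Q.grid (-n, 0), Q.grid_mem_dyadic _, le_of_eq_of_le ?_ hn.le⟩
  simp [grid]

lemma dyadicContent_eq_content (Q : Cube d) (hd : 1 ≤ d) {β : ℝ} (hβ : 0 < β) (E : Set (Euc d)) :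
    dyadicContent d β Q E = (Q.net hβ).content E := by
  classical
  apply le_antisymm
  · refine le_iInf₂ fun F hF => ENNReal.le_of_forall_pos_le_add fun δ hδ _ => ?_
    have : Nonempty (Fin d) := ⟨⟨0, hd⟩⟩
    obtain ⟨e⟩ : Nonempty (ℕ ≃ ℤ × (Fin d → ℤ)) := inferInstance
    obtain ⟨ε, hε, hsum⟩ :=
      ENNReal.exists_pos_sum_of_countable (ε := (δ : ℝ≥0∞)) (by simpa using hδ.ne') ℕ
    choose T hT hTle using fun i =>
      Q.exists_small_dyadic hβ (δ := (ε i : ℝ≥0∞)) (by simpa using hε i)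
    let c : ℕ → Cube d := fun i => if e i ∈ F then Q.grid (e i) else T i
    have hc : ∀ i, c i ∈ Q.dyadic := fun i => by
      by_cases h : e i ∈ F <;> simp [c, h, hT, grid_mem_dyadic]
    have hEc : E ⊆ ⋃ i, (c i).set := fun x hx => by
      obtain ⟨a, ha, hxa⟩ := (Q.net hβ).mem_cover.1 (hF hx)
      refine mem_iUnion.2 ⟨e.symm a, ?_⟩
      simpa [c, ha] using show x ∈ (Q.grid a).set from hxa
    calc dyadicContent d β Q E ≤ ∑' i, ENNReal.ofReal ((c i).side ^ β) :=
          iInf_le_of_le c (iInf₂_le hc hEc)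
      _ ≤ ∑' i, (F.indicator (Q.net hβ).weight (e i) + ε i) := by
          refine ENNReal.tsum_le_tsum fun i => ?_
          by_cases h : e i ∈ F
          · simp [c, h, net]
          · simpa [c, h] using hTle i
      _ = (Q.net hβ).mass F + ∑' i, (ε i : ℝ≥0∞) := by
          rw [ENNReal.tsum_add, e.tsum_eq (F.indicator (Q.net hβ).weight)]
          rfl
      _ ≤ (Q.net hβ).mass F + δ := by gcongr
  · refine le_iInf fun c => le_iInf₂ fun hc hE => ?_
    choose a ha using fun i => exists_eq_grid (hc i)
    have hcover : E ⊆ (Q.net hβ).cover (range a) := fun x hx => by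
      obtain ⟨i, hi⟩ := mem_iUnion.1 (hE hx)
      exact (Q.net hβ).mem_cover.2 ⟨a i, mem_range_self i, by rwa [ha i] at hi⟩
    calc (Q.net hβ).content E ≤ (Q.net hβ).mass (range a) :=
          (Q.net hβ).content_le hcover
      _ ≤ ∑' b, ∑' i, if b = a i then (Q.net hβ).weight b else 0 := by
          refine ENNReal.tsum_le_tsum fun b => ?_
          by_cases hb : b ∈ range a
          · obtain ⟨i, rfl⟩ := hb
            simpa using
              ENNReal.le_tsum (f := fun j => if a i = a j then (Q.net hβ).weight (a i) else 0) i
          · simp [hb]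
      _ = ∑' i, ENNReal.ofReal ((c i).side ^ β) := by
          rw [ENNReal.tsum_comm]
          refine tsum_congr fun i => ?_
          rw [tsum_ite_eq, ha i]
          rfl

end Cube

theorem dyadicContent_continuous_from_below (d : ℕ) (hd : 1 ≤ d) (β : ℝ) (hβ : 0 < β)
    (hβd : β ≤ (d : ℝ)) (Q : Cube d) (E : ℕ → Set (Euc d)) (hE : Monotone E) :
    Filter.Tendsto (fun n => dyadicContent d β Q (E n)) Filter.atTop
      (nhds (dyadicContent d β Q (⋃ n, E n))) := by
  simp only [Q.dyadicContent_eq_content hd hβ]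
  rw [(Q.net hβ).content_iUnion hE]
  exact tendsto_atTop_iSup ((Q.net hβ).content_mono.comp hE)

end
end

section
/- Let d ≥ 1, β ∈ (0,d], let Q ⊂ ℝ^d be a cube, and let E ⊂ ℝ^d. Then for 𝓗^β-almost every x ∈ E (with respect to the β-dimensional Hausdorff measure 𝓗^β), limsup_{Q' → x} 𝓗^{β,Q}_∞(E ∩ Q') / l(Q')^β = 1, where the limit superior is taken over cubes Q' ∈ 𝓓(Q) containing x as l(Q') → 0. -/
open Set MeasureTheory ENNReal NNReal Filter

noncomputable section

open Topology

section DyadicContent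

variable {d : ℕ} {β : ℝ} {Q : Cube d}

theorem dyadicContent_le_tsum {S : Set (Euc d)} (c : ℕ → Cube d) (hc : ∀ i, c i ∈ Q.dyadic)
    (hS : S ⊆ ⋃ i, (c i).set) :
    dyadicContent d β Q S ≤ ∑' i, ENNReal.ofReal ((c i).side ^ β) :=
  iInf_le_of_le c (iInf_le_of_le hc (iInf_le _ hS))

theorem exists_cover_of_dyadicContent_lt {S : Set (Euc d)} {a : ℝ≥0∞}
    (h : dyadicContent d β Q S < a) :
    ∃ c : ℕ → Cube d, (∀ i, c i ∈ Q.dyadic) ∧ S ⊆ ⋃ i, (c i).set ∧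
      ∑' i, ENNReal.ofReal ((c i).side ^ β) < a := by
  simpa only [dyadicContent, iInf_lt_iff, exists_prop] using h

theorem dyadicContent_mono {S T : Set (Euc d)} (h : S ⊆ T) :
    dyadicContent d β Q S ≤ dyadicContent d β Q T :=
  le_iInf fun c => le_iInf fun hc => le_iInf fun hT => dyadicContent_le_tsum c hc (h.trans hT)

theorem dyadicContent_iUnion_le (A : ℕ → Set (Euc d)) :
    dyadicContent d β Q (⋃ i, A i) ≤ ∑' i, dyadicContent d β Q (A i) := by
  refine ENNReal.le_of_forall_pos_le_add fun ε hε hfin => ?_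
  obtain ⟨δ, hδ, hsum⟩ := ENNReal.exists_pos_sum_of_countable (ENNReal.coe_pos.2 hε).ne' ℕ
  have hlt (i : ℕ) : dyadicContent d β Q (A i) < dyadicContent d β Q (A i) + δ i :=
    ENNReal.lt_add_right (ENNReal.ne_top_of_tsum_ne_top hfin.ne i) (ENNReal.coe_pos.2 (hδ i)).ne'
  choose c hc hcov hcsum using fun i => exists_cover_of_dyadicContent_lt (hlt i)
  let e : ℕ ≃ ℕ × ℕ := Nat.pairEquiv.symm
  calc dyadicContent d β Q (⋃ i, A i)
      ≤ ∑' n, ENNReal.ofReal ((c (e n).1 (e n).2).side ^ β) := by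
        refine dyadicContent_le_tsum (fun n => c (e n).1 (e n).2) (fun n => hc _ _) ?_
        refine iUnion_subset fun i x hx => ?_
        obtain ⟨j, hj⟩ := mem_iUnion.1 (hcov i hx)
        exact mem_iUnion.2 ⟨e.symm (i, j), by simpa using hj⟩
    _ = ∑' p : ℕ × ℕ, ENNReal.ofReal ((c p.1 p.2).side ^ β) :=
        e.tsum_eq fun p : ℕ × ℕ => ENNReal.ofReal ((c p.1 p.2).side ^ β)
    _ = ∑' i, ∑' j, ENNReal.ofReal ((c i j).side ^ β) :=
        ENNReal.tsum_prod (f := fun i j => ENNReal.ofReal ((c i j).side ^ β))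
    _ ≤ ∑' i, (dyadicContent d β Q (A i) + δ i) := ENNReal.tsum_le_tsum fun i => (hcsum i).le
    _ ≤ ∑' i, dyadicContent d β Q (A i) + ε := by
        rw [ENNReal.tsum_add]
        gcongr

theorem dyadicCubeAt_mem_dyadic (Q : Cube d) (n : ℕ) (x : Euc d) :
    dyadicCubeAt Q n x ∈ Q.dyadic := by
  refine ⟨-n, fun i => ⌊(x i - Q.corner i) / (Q.side * (2 : ℝ)⁻¹ ^ n)⌋, ?_, fun i => ?_⟩
  · simp [dyadicCubeAt]
  · simp [dyadicCubeAt, mul_comm]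

theorem mem_dyadicCubeAt (Q : Cube d) (n : ℕ) (x : Euc d) : x ∈ (dyadicCubeAt Q n x).set := by
  intro i
  have hs : 0 < Q.side * (2 : ℝ)⁻¹ ^ n := (dyadicCubeAt Q n x).side_pos
  have h1 := Int.floor_le ((x i - Q.corner i) / (Q.side * (2 : ℝ)⁻¹ ^ n))
  have h2 := Int.lt_floor_add_one ((x i - Q.corner i) / (Q.side * (2 : ℝ)⁻¹ ^ n))
  rw [le_div_iff₀ hs] at h1
  rw [div_lt_iff₀ hs] at h2
  simp only [dyadicCubeAt]
  constructor <;> linarith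

theorem exists_dyadicCubeAt_eq {c : Cube d} (hc : c ∈ Q.dyadic) {x : Euc d} (hx : x ∈ c.set)
    {n : ℕ} (hn : c.side < Q.side * (2 : ℝ)⁻¹ ^ n) : ∃ j, n ≤ j ∧ dyadicCubeAt Q j x = c := by
  obtain ⟨z, k, hside, hcorner⟩ := hc
  have hz : z < -(n : ℤ) := by
    rw [hside, mul_lt_mul_iff_right₀ Q.side_pos, inv_pow, ← zpow_natCast, ← zpow_neg] at hn
    exact (zpow_lt_zpow_iff_right₀ _root_.one_lt_two).1 hn
  obtain ⟨j, rfl⟩ : ∃ j : ℕ, z = -(j : ℤ) := ⟨(-z).toNat, by omega⟩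
  have hpow : (2 : ℝ) ^ (-(j : ℤ)) = (2 : ℝ)⁻¹ ^ j := by simp
  rw [hpow] at hside hcorner
  have hs : 0 < Q.side * (2 : ℝ)⁻¹ ^ j := hside ▸ c.side_pos
  refine ⟨j, by omega, ?_⟩
  obtain ⟨a, s, hpos⟩ := c
  obtain rfl : s = _ := hside
  obtain rfl : a = _ := funext hcorner
  simp only [dyadicCubeAt, Cube.mk.injEq, and_true]
  funext i
  have hi := hx i
  have : ⌊(x i - Q.corner i) / (Q.side * (2 : ℝ)⁻¹ ^ j)⌋ = k i := by
    rw [Int.floor_eq_iff, le_div_iff₀ hs, div_lt_iff₀ hs]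
    simp only at hi
    constructor <;> linarith
  rw [this, mul_comm]

theorem exists_dyadic_side_rpow_lt (hβ : 0 < β) (Q : Cube d) {ε : ℝ≥0∞} (hε : 0 < ε) :
    ∃ c ∈ Q.dyadic, ENNReal.ofReal (c.side ^ β) < ε := by
  have h : Tendsto (fun n : ℕ => ENNReal.ofReal ((Q.side * (2 : ℝ)⁻¹ ^ n) ^ β)) atTop (𝓝 0) := by
    have h0 : Tendsto (fun n : ℕ => Q.side * (2 : ℝ)⁻¹ ^ n) atTop (𝓝 0) := by
      simpa using (tendsto_pow_atTop_nhds_zero_of_lt_one (r := (2 : ℝ)⁻¹) (by norm_num)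
        (by norm_num)).const_mul Q.side
    simpa [Real.zero_rpow hβ.ne'] using
      ENNReal.tendsto_ofReal (h0.rpow_const (p := β) (Or.inr hβ.le))
  obtain ⟨n, hn⟩ := (h.eventually_lt_const hε).exists
  exact ⟨dyadicCubeAt Q n 0, dyadicCubeAt_mem_dyadic Q n 0, hn⟩

theorem exists_dyadic_seq_tsum_lt (hβ : 0 < β) (Q : Cube d) {ε : ℝ≥0∞} (hε : ε ≠ 0) :
    ∃ c : ℕ → Cube d, (∀ i, c i ∈ Q.dyadic) ∧ ∑' i, ENNReal.ofReal ((c i).side ^ β) < ε := by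
  obtain ⟨δ, hδ, hsum⟩ := ENNReal.exists_pos_sum_of_countable hε ℕ
  choose c hc hlt using fun i => exists_dyadic_side_rpow_lt hβ Q (ENNReal.coe_pos.2 (hδ i))
  exact ⟨c, hc, (ENNReal.tsum_le_tsum fun i => (hlt i).le).trans_lt hsum⟩

theorem dyadicContent_empty (hβ : 0 < β) (Q : Cube d) : dyadicContent d β Q ∅ = 0 := by
  by_contra h
  obtain ⟨c, hc, hlt⟩ := exists_dyadic_seq_tsum_lt hβ Q h
  exact hlt.not_ge (dyadicContent_le_tsum c hc (empty_subset _))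

theorem dyadicContent_le_of_subset (hβ : 0 < β) {c : Cube d} (hc : c ∈ Q.dyadic)
    {S : Set (Euc d)} (hS : S ⊆ c.set) :
    dyadicContent d β Q S ≤ ENNReal.ofReal (c.side ^ β) := by
  refine ENNReal.le_of_forall_pos_le_add fun ε hε _ => ?_
  obtain ⟨c', hc', hlt⟩ := exists_dyadic_seq_tsum_lt hβ Q (ENNReal.coe_pos.2 hε).ne'
  let b : ℕ → Cube d := fun i => Nat.casesOn i c c'
  calc dyadicContent d β Q S
      ≤ ∑' i, ENNReal.ofReal ((b i).side ^ β) := by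
        refine dyadicContent_le_tsum b (fun i => ?_) fun x hx => mem_iUnion.2 ⟨0, hS hx⟩
        cases i
        exacts [hc, hc' _]
    _ = ENNReal.ofReal (c.side ^ β) + ∑' i, ENNReal.ofReal ((c' i).side ^ β) :=
        tsum_eq_zero_add' ENNReal.summable
    _ ≤ ENNReal.ofReal (c.side ^ β) + ε := by gcongr

theorem Cube.ediam_set_le (c : Cube d) : Metric.ediam c.set ≤ ENNReal.ofReal (d * c.side) := by
  refine Metric.ediam_le fun x hx y hy => ?_
  rw [edist_dist]
  refine ENNReal.ofReal_le_ofReal ?_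
  rw [EuclideanSpace.dist_eq]
  have hnn (i : Fin d) : dist (x i) (y i) ≤ c.side := by
    have h1 := hx i
    have h2 := hy i
    rw [Real.dist_eq, abs_le]
    constructor <;> linarith
  have hs := c.side_pos.le
  rw [Real.sqrt_le_left (by positivity)]
  calc ∑ i, dist (x i) (y i) ^ 2 ≤ ∑ _i : Fin d, c.side ^ 2 :=
        Finset.sum_le_sum fun i _ => by gcongr; exact hnn i
    _ = d * c.side ^ 2 := by simp
    _ ≤ (d : ℝ) ^ 2 * c.side ^ 2 := by
        gcongr
        exact_mod_cast Nat.le_self_pow two_ne_zero d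
    _ = (d * c.side) ^ 2 := by ring

theorem hausdorffMeasure_eq_zero_of_dyadicContent_eq_zero (hβ : 0 < β) {S : Set (Euc d)}
    (hS : dyadicContent d β Q S = 0) : (Measure.hausdorffMeasure β : Measure (Euc d)) S = 0 := by
  have hd0 : (0 : ℝ) ≤ d := d.cast_nonneg
  let r : ℕ → ℝ := fun n => (2 : ℝ)⁻¹ ^ n
  have hr (n : ℕ) : 0 < r n := by positivity
  have hr0 : Tendsto r atTop (𝓝 0) :=
    tendsto_pow_atTop_nhds_zero_of_lt_one (by norm_num) (by norm_num)
  have hlt (n : ℕ) : dyadicContent d β Q S < ENNReal.ofReal (r n ^ β) := by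
    rw [hS, ENNReal.ofReal_pos]
    exact Real.rpow_pos_of_pos (hr n) β
  choose c hc hcov hsum using fun n => exists_cover_of_dyadicContent_lt (hlt n)
  have hside (n i : ℕ) : (c n i).side ≤ r n := by
    have h := (ENNReal.le_tsum i).trans (hsum n).le
    rw [ENNReal.ofReal_le_ofReal_iff (Real.rpow_nonneg (hr n).le β)] at h
    exact (Real.rpow_le_rpow_iff (c n i).side_pos.le (hr n).le hβ).1 h
  have hrad : Tendsto (fun n => ENNReal.ofReal (d * r n)) atTop (𝓝 0) := by
    simpa using ENNReal.tendsto_ofReal (hr0.const_mul (d : ℝ))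
  have hbound : Tendsto (fun n => ENNReal.ofReal (d * r n) ^ β) atTop (𝓝 0) := by
    simpa [ENNReal.zero_rpow_of_pos hβ] using hrad.ennrpow_const β
  refine le_antisymm ?_ zero_le
  calc (Measure.hausdorffMeasure β : Measure (Euc d)) S
      ≤ liminf (fun n => ∑' i, Metric.ediam (c n i).set ^ β) atTop :=
        Measure.hausdorffMeasure_le_liminf_tsum β S _ hrad (fun n i => (c n i).set)
          (Eventually.of_forall fun n i => (c n i).ediam_set_le.trans
            (ENNReal.ofReal_le_ofReal (by gcongr; exact hside n i)))
          (Eventually.of_forall hcov)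
    _ ≤ liminf (fun n => ENNReal.ofReal (d * r n) ^ β) atTop := by
        refine liminf_le_liminf (Eventually.of_forall fun n => ?_)
        calc ∑' i, Metric.ediam (c n i).set ^ β
            ≤ ∑' i, ENNReal.ofReal d ^ β * ENNReal.ofReal ((c n i).side ^ β) := by
              refine ENNReal.tsum_le_tsum fun i => ?_
              rw [← ENNReal.ofReal_rpow_of_pos (c n i).side_pos,
                ← ENNReal.mul_rpow_of_nonneg _ _ hβ.le, ← ENNReal.ofReal_mul hd0]
              exact ENNReal.rpow_le_rpow (c n i).ediam_set_le hβ.le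
          _ ≤ ENNReal.ofReal d ^ β * ENNReal.ofReal (r n ^ β) := by
              rw [ENNReal.tsum_mul_left]
              gcongr
              exact (hsum n).le
          _ = ENNReal.ofReal (d * r n) ^ β := by
              rw [← ENNReal.ofReal_rpow_of_pos (hr n), ← ENNReal.mul_rpow_of_nonneg _ _ hβ.le,
                ← ENNReal.ofReal_mul hd0]
    _ = 0 := hbound.liminf_eq

/-- If at every point of `F` all dyadic cubes of generation at least `m` have content density of
`F` below `t`, then the densities of `F` are in fact below every power of `t`. -/
theorem dyadicContent_inter_le_pow_mul (hβ : 0 < β) {t : ℝ≥0∞} (ht : t ≤ 1) {m : ℕ}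
    {F : Set (Euc d)}
    (hF : ∀ x ∈ F, ∀ n ≥ m, dyadicContent d β Q (F ∩ (dyadicCubeAt Q n x).set) <
      t * ENNReal.ofReal ((dyadicCubeAt Q n x).side ^ β)) (k : ℕ) :
    ∀ x ∈ F, ∀ n ≥ m, dyadicContent d β Q (F ∩ (dyadicCubeAt Q n x).set) ≤
      t ^ k * ENNReal.ofReal ((dyadicCubeAt Q n x).side ^ β) := by
  induction k with
  | zero =>
    intro x _ n _
    rw [pow_zero, one_mul]
    exact dyadicContent_le_of_subset hβ (dyadicCubeAt_mem_dyadic Q n x) inter_subset_right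
  | succ k ih =>
    intro x hx n hn
    obtain ⟨c, hc, hcov, hsum⟩ := exists_cover_of_dyadicContent_lt (hF x hx n hn)
    have hpiece (i : ℕ) : dyadicContent d β Q (F ∩ (c i).set) ≤
        t ^ k * ENNReal.ofReal ((c i).side ^ β) := by
      rcases (F ∩ (c i).set).eq_empty_or_nonempty with h | ⟨y, hyF, hyc⟩
      · rw [h, dyadicContent_empty hβ]
        exact zero_le
      · have hlt : ENNReal.ofReal ((c i).side ^ β) <
            ENNReal.ofReal ((dyadicCubeAt Q n x).side ^ β) :=
          (ENNReal.le_tsum i).trans_lt (hsum.trans_le (mul_le_of_le_one_left' ht))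
        have hpos := (dyadicCubeAt Q n x).side_pos
        rw [ENNReal.ofReal_lt_ofReal_iff (Real.rpow_pos_of_pos hpos β),
          Real.rpow_lt_rpow_iff (c i).side_pos.le hpos.le hβ] at hlt
        obtain ⟨j, hj, hji⟩ := exists_dyadicCubeAt_eq (hc i) hyc hlt
        simpa only [hji] using ih y hyF j (hn.trans hj)
    calc dyadicContent d β Q (F ∩ (dyadicCubeAt Q n x).set)
        ≤ dyadicContent d β Q (⋃ i, F ∩ (c i).set) :=
          dyadicContent_mono (by
            rw [← inter_iUnion]
            exact subset_inter inter_subset_left hcov)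
      _ ≤ ∑' i, dyadicContent d β Q (F ∩ (c i).set) := dyadicContent_iUnion_le _
      _ ≤ ∑' i, t ^ k * ENNReal.ofReal ((c i).side ^ β) := ENNReal.tsum_le_tsum hpiece
      _ ≤ t ^ k * (t * ENNReal.ofReal ((dyadicCubeAt Q n x).side ^ β)) := by
          rw [ENNReal.tsum_mul_left]
          gcongr
      _ = t ^ (k + 1) * ENNReal.ofReal ((dyadicCubeAt Q n x).side ^ β) := by
          rw [pow_succ, mul_assoc]

theorem hausdorffMeasure_eq_zero_of_dyadicContent_lt (hβ : 0 < β) {t : ℝ≥0∞} (ht : t < 1) {m : ℕ}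
    {F : Set (Euc d)}
    (hF : ∀ x ∈ F, ∀ n ≥ m, dyadicContent d β Q (F ∩ (dyadicCubeAt Q n x).set) <
      t * ENNReal.ofReal ((dyadicCubeAt Q n x).side ^ β)) :
    (Measure.hausdorffMeasure β : Measure (Euc d)) F = 0 := by
  have hnull (x : Euc d) (hx : x ∈ F) :
      (Measure.hausdorffMeasure β : Measure (Euc d)) (F ∩ (dyadicCubeAt Q m x).set) = 0 := by
    refine hausdorffMeasure_eq_zero_of_dyadicContent_eq_zero (Q := Q) hβ (le_antisymm ?_ zero_le)
    have hlim : Tendsto (fun k : ℕ => t ^ k * ENNReal.ofReal ((dyadicCubeAt Q m x).side ^ β))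
        atTop (𝓝 0) := by
      simpa using ENNReal.Tendsto.mul_const (ENNReal.tendsto_pow_atTop_nhds_zero_of_lt_one ht)
        (Or.inr ENNReal.ofReal_ne_top)
    exact ge_of_tendsto' hlim fun k => dyadicContent_inter_le_pow_mul hβ ht.le hF k x hx m le_rfl
  let g : Euc d → Fin d → ℤ := fun x i => ⌊(x i - Q.corner i) / (Q.side * (2 : ℝ)⁻¹ ^ m)⌋
  have hcover : F ⊆ ⋃ k : Fin d → ℤ, F ∩ g ⁻¹' {k} := fun x hx => mem_iUnion.2 ⟨g x, hx, rfl⟩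
  refine measure_mono_null hcover (measure_iUnion_null fun k => ?_)
  rcases (F ∩ g ⁻¹' {k}).eq_empty_or_nonempty with h | ⟨x, hxF, hxk⟩
  · rw [h, measure_empty]
  · refine measure_mono_null (fun y hy => mem_inter hy.1 ?_) (hnull x hxF)
    have hyx : g y = g x := (mem_singleton_iff.1 hy.2).trans (mem_singleton_iff.1 hxk).symm
    have hcube : dyadicCubeAt Q m y = dyadicCubeAt Q m x := by
      simp only [dyadicCubeAt, Cube.mk.injEq, and_true]
      funext i
      have hi : ⌊(y i - Q.corner i) / (Q.side * (2 : ℝ)⁻¹ ^ m)⌋ =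
        ⌊(x i - Q.corner i) / (Q.side * (2 : ℝ)⁻¹ ^ m)⌋ := congrFun hyx i
      rw [hi]
    exact hcube ▸ mem_dyadicCubeAt Q m y

end DyadicContent

theorem dyadicContent_upper_density (d : ℕ) (hd : 1 ≤ d) (β : ℝ) (hβ : 0 < β)
    (hβd : β ≤ (d : ℝ)) (Q : Cube d) (E : Set (Euc d)) :
    ∀ᵐ x ∂(Measure.hausdorffMeasure β : Measure (Euc d)), x ∈ E →
      Filter.limsup (fun n : ℕ =>
          dyadicContent d β Q (E ∩ (dyadicCubeAt Q n x).set) /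
            ENNReal.ofReal ((dyadicCubeAt Q n x).side ^ β)) Filter.atTop = 1 := by
  let ρ : Euc d → ℕ → ℝ≥0∞ := fun x n =>
    dyadicContent d β Q (E ∩ (dyadicCubeAt Q n x).set) /
      ENNReal.ofReal ((dyadicCubeAt Q n x).side ^ β)
  have hnull (q : ℚ) (m : ℕ) : ∀ᵐ x ∂(Measure.hausdorffMeasure β : Measure (Euc d)),
      ((Real.toNNReal q : ℝ≥0∞) < 1) → ¬ (x ∈ E ∧ ∀ n ≥ m, ρ x n < Real.toNNReal q) := by
    by_cases hq : (Real.toNNReal q : ℝ≥0∞) < 1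
    · have hzero := hausdorffMeasure_eq_zero_of_dyadicContent_lt (Q := Q) (m := m) hβ hq
        (F := {x | x ∈ E ∧ ∀ n ≥ m, ρ x n < Real.toNNReal q}) (fun x hx n hn =>
          (dyadicContent_mono (inter_subset_inter_left _ fun y hy => hy.1)).trans_lt
            ((ENNReal.div_lt_iff (Or.inl (ENNReal.ofReal_pos.2
              (Real.rpow_pos_of_pos (dyadicCubeAt Q n x).side_pos β)).ne')
              (Or.inl ENNReal.ofReal_ne_top)).1 (hx.2 n hn)))
      filter_upwards [measure_eq_zero_iff_ae_notMem.1 hzero] with x hx _ using hx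
    · exact Eventually.of_forall fun x h => absurd h hq
  filter_upwards [ae_all_iff.2 fun q => ae_all_iff.2 (hnull q)] with x hx hxE
  change limsup (ρ x) atTop = 1
  refine le_antisymm ?_ (not_lt.1 fun hlt => ?_)
  · refine limsup_le_of_le (h := Eventually.of_forall fun n => ENNReal.div_le_of_le_mul ?_)
    rw [one_mul]
    exact dyadicContent_le_of_subset hβ (dyadicCubeAt_mem_dyadic Q n x) inter_subset_right
  · obtain ⟨q, _, hq, hq1⟩ := ENNReal.lt_iff_exists_rat_btwn.1 hlt
    obtain ⟨m, hm⟩ := eventually_atTop.1 (eventually_lt_of_limsup_lt hq)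
    exact hx q m hq1 ⟨hxE, hm⟩

end
end
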